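/- arXiv:2306.02872 — 4 statements merged into one kernel-verified Lean document; each statement's English description precedes it below -/
import Mathlib

section
/- Let γ(s) = Q^s·∏_{j=1}^r Γ(λ_j s + μ_j) with Q, λ_j > 0, μ_j ∈ ℂ with Re(μ_j) > -λ_j/2, and Σ λ_j = 1. If γ(s) has poles at all but finitely many nonpositive integers, then γ(s) = C·P(s)·H^s·Γ_ℂ(s) where C, H > 0, Γ_ℂ(s) = 2(2π)^{-s}Γ(s), and P(s) is a monic polynomial whose roots are distinct nonpositive integers. -/
open scoped Real BigOperators

/-- `Γ_ℂ(s) = 2 (2π)^{-s} Γ(s)`. -/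
noncomputable def GammaC (s : ℂ) : ℂ :=
  2 * ((2 * Real.pi : ℝ) : ℂ) ^ (-s) * Complex.Gamma s

open Classical in
/-- Complementing a cover: if sets `p j`, `j ≠ i`, with counting functions at most `lam j * N + 1`
cover together with `q` all but finitely many naturals, and `∑ j, lam j = 1`, then `q` has
counting function at least `lam i * N - C`. -/
lemma exists_le_card_filter_of_cover {ι : Type*} [Fintype ι] {p : ι → ℕ → Prop} {lam : ι → ℝ}
    (hsum : ∑ j, lam j = 1)
    (hp : ∀ j (N : ℕ), (((Finset.range N).filter (p j)).card : ℝ) ≤ lam j * N + 1)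
    (i : ι) (q : ℕ → Prop) (hfin : {m | ¬ (q m ∨ ∃ j ≠ i, p j m)}.Finite) :
    ∃ C : ℝ, ∀ N : ℕ, lam i * N - C ≤ (((Finset.range N).filter q).card : ℝ) := by
  refine ⟨hfin.toFinset.card + Fintype.card ι, fun N => ?_⟩
  have hsub : Finset.range N ⊆ hfin.toFinset ∪ ((Finset.range N).filter q ∪
      (Finset.univ.erase i).biUnion fun j => (Finset.range N).filter (p j)) := by
    intro m hm
    by_cases h : q m ∨ ∃ j ≠ i, p j m
    · rcases h with h | ⟨j, hj, h⟩
      · simp only [Finset.mem_union, Finset.mem_filter]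
        exact .inr (.inl ⟨hm, h⟩)
      · simp only [Finset.mem_union, Finset.mem_biUnion, Finset.mem_filter]
        exact .inr (.inr ⟨j, by simp [hj], hm, h⟩)
    · exact Finset.mem_union_left _ (hfin.mem_toFinset.2 h)
  have h1 := (Finset.card_le_card hsub).trans ((Finset.card_union_le _ _).trans
    (Nat.add_le_add_left ((Finset.card_union_le _ _).trans
      (Nat.add_le_add_left Finset.card_biUnion_le _)) _))
  rw [Finset.card_range] at h1
  have h2 : (N : ℝ) ≤ hfin.toFinset.card + (((Finset.range N).filter q).card +
      ∑ j ∈ Finset.univ.erase i, (((Finset.range N).filter (p j)).card : ℝ)) := by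
    exact_mod_cast h1
  have h3 : ∑ j ∈ Finset.univ.erase i, (((Finset.range N).filter (p j)).card : ℝ) ≤
      ∑ j ∈ Finset.univ.erase i, (lam j * N + 1) := Finset.sum_le_sum fun j _ => hp j N
  have h4 : ∑ j ∈ Finset.univ.erase i, (lam j * N + 1) + (lam i * N + 1) =
      N + Fintype.card ι := by
    rw [Finset.sum_erase_add _ _ (Finset.mem_univ i), Finset.sum_add_distrib, ← Finset.sum_mul,
      hsum]
    simp
  linarith

/-- A linear function with bounded values on the naturals has nonpositive slope. -/
lemma nonpos_of_forall_mul_natCast_le {c C : ℝ} (h : ∀ N : ℕ, c * N ≤ C) : c ≤ 0 := by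
  by_contra! hc
  obtain ⟨N, hN⟩ := exists_nat_gt (C / c)
  have := h N
  rw [div_lt_iff₀ hc] at hN
  linarith

/-- `l * (-m) + u` is a pole of `Γ`. -/
def IsGammaPole (l : ℝ) (u : ℂ) (m : ℕ) : Prop := ∃ k : ℕ, (l : ℂ) * (-(m : ℂ)) + u = -(k : ℂ)

open Classical in
lemma card_filter_isGammaPole_le {l : ℝ} {u : ℂ} (hl : 0 < l) (hu : -l / 2 < u.re) (N : ℕ) :
    (((Finset.range N).filter (IsGammaPole l u)).card : ℝ) ≤ l * N + 1 := by
  have key : ∀ m, IsGammaPole l u m → (⌊l * m - u.re⌋₊ : ℝ) = l * m - u.re := by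
    rintro m ⟨k, hk⟩
    have := congrArg Complex.re hk
    simp at this
    have h : l * m - u.re = k := by linarith
    rw [h, Nat.floor_natCast]
  have hcard : ((Finset.range N).filter (IsGammaPole l u)).card ≤
      (Finset.range ⌈l * N⌉₊).card := by
    refine Finset.card_le_card_of_injOn (fun m => ⌊l * m - u.re⌋₊) ?_ ?_
    · intro m hm
      simp only [Finset.coe_filter, Finset.mem_range, Set.mem_ofPred_eq] at hm
      have h1 := key m hm.2
      have h2 : (m : ℝ) + 1 ≤ N := by exact_mod_cast hm.1
      simp only [Finset.coe_range, Set.mem_Iio, Nat.lt_ceil]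
      rw [h1]
      nlinarith
    · intro m hm m' hm' h
      simp only [Finset.coe_filter, Set.mem_ofPred_eq] at hm hm'
      have h1 := key m hm.2
      have h2 := key m' hm'.2
      simp only at h
      rw [h, h2] at h1
      have : l * m = l * m' := by linarith
      exact_mod_cast mul_left_cancel₀ hl.ne' this
  rw [Finset.card_range] at hcard
  have h1 : (((Finset.range N).filter (IsGammaPole l u)).card : ℝ) ≤ ⌈l * N⌉₊ := by
    exact_mod_cast hcard
  have h2 := Nat.ceil_lt_add_one (a := l * N) (by positivity)
  linarith

lemma card_le_of_forall_dvd_sub {A : Finset ℕ} {N q : ℕ} (hA : A ⊆ Finset.range N)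
    (h : ∀ x ∈ A, ∀ y ∈ A, (q : ℤ) ∣ x - y) : (A.card : ℝ) ≤ N / q + 1 := by
  have hcard : A.card ≤ (Finset.range (N / q + 1)).card := by
    refine Finset.card_le_card_of_injOn (fun m => m / q) ?_ ?_
    · intro m hm
      have := Finset.mem_range.1 (hA hm)
      simp only [Finset.coe_range, Set.mem_Iio]
      exact Nat.lt_succ_of_le (Nat.div_le_div_right this.le)
    · intro x hx y hy hxy
      have h1 : y ≡ x [MOD q] := (Nat.modEq_iff_dvd).2 (h x hx y hy)
      have h2 := Nat.div_add_mod x q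
      have h3 := Nat.div_add_mod y q
      simp only at hxy
      rw [hxy] at h2
      have h4 : y % q = x % q := h1
      omega
  rw [Finset.card_range] at hcard
  calc (A.card : ℝ) ≤ ((N / q + 1 : ℕ) : ℝ) := by exact_mod_cast hcard
    _ ≤ N / q + 1 := by push_cast; gcongr; exact Nat.cast_div_le

open Classical in
lemma exists_eq_natCast_div_of_le_card {l : ℝ} {u : ℂ} (hl : 0 < l) (hu : -l / 2 < u.re) {C : ℝ}
    (hC : ∀ N : ℕ, l * N - C ≤ (((Finset.range N).filter (IsGammaPole l u)).card : ℝ)) :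
    ∃ q a : ℕ, 0 < q ∧ l = 1 / q ∧ u = a / q := by
  have hmany : ∃ x y, x ≠ y ∧ IsGammaPole l u x ∧ IsGammaPole l u y := by
    by_contra! hcon
    have : l ≤ 0 := by
      refine nonpos_of_forall_mul_natCast_le (C := C + 1) fun N => ?_
      have h1 := hC N
      have h2 : ((Finset.range N).filter (IsGammaPole l u)).card ≤ 1 := by
        rw [Finset.card_le_one]
        intro x hx y hy
        by_contra hxy
        exact hcon x y hxy (Finset.mem_filter.1 hx).2 (Finset.mem_filter.1 hy).2
      have h3 : (((Finset.range N).filter (IsGammaPole l u)).card : ℝ) ≤ 1 := by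
        exact_mod_cast h2
      linarith
    linarith
  have hsub : ∀ x y, IsGammaPole l u x → IsGammaPole l u y →
      ∃ d : ℤ, l * ((x : ℤ) - (y : ℤ) : ℤ) = d := by
    rintro x y ⟨k, hk⟩ ⟨k', hk'⟩
    have h1 := congrArg Complex.re hk
    have h2 := congrArg Complex.re hk'
    simp at h1 h2
    refine ⟨(k : ℤ) - k', ?_⟩
    push_cast
    linarith
  obtain ⟨t, ht⟩ : ∃ t : ℚ, (t : ℝ) = l := by
    obtain ⟨x, y, hxy, hx, hy⟩ := hmany
    obtain ⟨d, hd⟩ := hsub x y hx hy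
    refine ⟨d / ((x : ℤ) - (y : ℤ) : ℤ), ?_⟩
    have : (((x : ℤ) - (y : ℤ) : ℤ) : ℝ) ≠ 0 := by
      exact Int.cast_ne_zero.2 (sub_ne_zero.2 (by exact_mod_cast hxy))
    rw [Rat.cast_div, Rat.cast_intCast, Rat.cast_intCast, ← hd]
    field_simp
  have hdvd : ∀ x y, IsGammaPole l u x → IsGammaPole l u y → (t.den : ℤ) ∣ x - y := by
    intro x y hx hy
    obtain ⟨d, hd⟩ := hsub x y hx hy
    have h1 : t * ((x : ℤ) - (y : ℤ) : ℤ) = d := by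
      rw [← ht] at hd
      exact_mod_cast hd
    have h2 : t.num * ((x : ℤ) - y) = d * t.den := by
      have h3 : (t.den : ℚ) ≠ 0 := by exact_mod_cast t.den_nz
      have h4 : (t.num : ℚ) = t * t.den := (Rat.mul_den_eq_num t).symm
      have : (t.num : ℚ) * ((x : ℤ) - (y : ℤ) : ℤ) = d * t.den := by
        rw [h4, ← h1]; ring
      exact_mod_cast this
    have h5 : IsCoprime (t.den : ℤ) t.num := by
      rw [Int.isCoprime_iff_nat_coprime]
      simpa using t.reduced.symm
    exact h5.dvd_of_dvd_mul_left ⟨d, by rw [h2]; ring⟩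
  have hden : (0 : ℝ) < t.den := by exact_mod_cast t.den_pos
  have hnd : l * t.den = t.num := by
    rw [← ht]; exact_mod_cast Rat.mul_den_eq_num t
  have hle : l - 1 / t.den ≤ 0 := by
    refine nonpos_of_forall_mul_natCast_le (C := C + 1) fun N => ?_
    have h1 := hC N
    have h2 := card_le_of_forall_dvd_sub
      (Finset.filter_subset (IsGammaPole l u) (Finset.range N)) fun x hx y hy =>
        hdvd x y (Finset.mem_filter.1 hx).2 (Finset.mem_filter.1 hy).2
    have h3 : (l - 1 / t.den) * N = l * N - N / t.den := by ring
    linarith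
  have hnum : t.num = 1 := by
    have h1 : (0 : ℝ) < t.num := by rw [← hnd]; positivity
    have h2 : (t.num : ℝ) ≤ 1 := by
      rw [← hnd]
      have : l ≤ 1 / t.den := by linarith
      rwa [le_div_iff₀ hden] at this
    have h3 : 0 < t.num := by exact_mod_cast h1
    have h4 : t.num ≤ 1 := by exact_mod_cast h2
    omega
  have hl' : l = 1 / t.den := by
    rw [hnum] at hnd
    rw [eq_div_iff hden.ne', hnd]; simp
  obtain ⟨x, -, -, ⟨k, hk⟩, -⟩ := hmany
  have hdenC : (t.den : ℂ) ≠ 0 := by exact_mod_cast t.den_nz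
  have hu' : u = (((x : ℤ) - k * t.den : ℤ) : ℂ) / t.den := by
    rw [hl'] at hk
    push_cast at hk ⊢
    field_simp at hk ⊢
    linear_combination hk
  have hpos : 0 ≤ (x : ℤ) - k * t.den := by
    have h1 : u.re = (((x : ℤ) - k * t.den : ℤ) : ℝ) / t.den := by
      rw [hu']
      rw [← Complex.ofReal_intCast, ← Complex.ofReal_natCast, ← Complex.ofReal_div,
        Complex.ofReal_re]
    rw [h1, hl', lt_div_iff₀ hden] at hu
    have h2 : (-1 : ℝ) < (((x : ℤ) - k * t.den : ℤ) : ℝ) := by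
      have : -(1 / (t.den : ℝ)) / 2 * t.den = -1 / 2 := by field_simp
      linarith
    have h3 : -1 < (x : ℤ) - k * t.den := by exact_mod_cast h2
    omega
  obtain ⟨a, ha⟩ := Int.eq_ofNat_of_zero_le hpos
  exact ⟨t.den, a, t.den_pos, hl', by rw [hu', ha]; simp⟩

/-- The number of `k` with `a + q * k < N`. -/
def progressionCount (a q N : ℕ) : ℕ := (N - a + (q - 1)) / q

lemma lt_progressionCount_iff {a q N k : ℕ} (hq : 0 < q) :
    k < progressionCount a q N ↔ a + q * k < N := by
  rw [progressionCount, ← Nat.succ_le_iff, Nat.le_div_iff_mul_le hq, Nat.succ_mul, mul_comm k q]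
  omega

lemma tendsto_progressionCount_sub_one_div (a : ℕ) {q : ℕ} (hq : 0 < q) :
    Filter.Tendsto (fun n : ℕ => ((progressionCount a q (n + 1) - 1 : ℕ) : ℝ) / n) Filter.atTop
      (nhds (1 / q)) := by
  have hq' : (0 : ℝ) < q := by exact_mod_cast hq
  rw [tendsto_iff_norm_sub_tendsto_zero]
  refine squeeze_zero' (Filter.Eventually.of_forall fun n => norm_nonneg _) ?_
    (tendsto_const_div_atTop_nhds_zero_nat ((a + q + 1 : ℝ)))
  filter_upwards [Filter.eventually_gt_atTop (a + q)] with n hn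
  have hn' : (0 : ℝ) < n := by exact_mod_cast (by omega : 0 < n)
  set c := progressionCount a q (n + 1) - 1 with hc
  have h1 : 1 ≤ progressionCount a q (n + 1) := (lt_progressionCount_iff hq).2 (by omega)
  have h2 : a + q * c < n + 1 := (lt_progressionCount_iff hq).1 (by omega)
  have h3 : ¬ a + q * (c + 1) < n + 1 := by
    rw [← lt_progressionCount_iff hq]; omega
  have h4 : (a : ℝ) + q * c < n + 1 := by exact_mod_cast h2
  have h5 : (n : ℝ) + 1 ≤ a + q * (c + 1) := by exact_mod_cast not_lt.1 h3
  have ha : (0 : ℝ) ≤ a := by positivity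
  have hq1 : (1 : ℝ) ≤ q := by exact_mod_cast hq
  have h6 : (c : ℝ) / n - 1 / q = (q * c - n) / (q * n) := by field_simp
  rw [h6, Real.norm_eq_abs, abs_div, abs_of_pos (by positivity : (0 : ℝ) < q * n)]
  refine div_le_div₀ (by positivity) (abs_le.2 ⟨by linarith, by linarith⟩) hn' ?_
  nlinarith

lemma prod_progression_mul_prod_compl {ι M : Type*} [Fintype ι] [CommMonoid M] {a q : ι → ℕ}
    (hq : ∀ j, 0 < q j) (hdisj : ∀ i j, i ≠ j → ∀ k l, a i + q i * k ≠ a j + q j * l)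
    {F : Finset ℕ} (hF : ∀ m, m ∈ F ↔ ¬ ∃ j k, m = a j + q j * k) (f : ℕ → M) {N : ℕ}
    (hN : F ⊆ Finset.range N) :
    (∏ j, ∏ k ∈ Finset.range (progressionCount (a j) (q j) N), f (a j + q j * k)) *
      ∏ m ∈ F, f m = ∏ m ∈ Finset.range N, f m := by
  classical
  let A : ι → Finset ℕ := fun j =>
    (Finset.range (progressionCount (a j) (q j) N)).image fun k => a j + q j * k
  have hA : ∀ j, ∏ k ∈ Finset.range (progressionCount (a j) (q j) N), f (a j + q j * k) =
      ∏ m ∈ A j, f m := by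
    intro j
    rw [Finset.prod_image]
    intro k _ l _ h
    exact Nat.eq_of_mul_eq_mul_left (hq j) (Nat.add_left_cancel h)
  rw [Finset.prod_congr rfl fun j _ => hA j, ← Finset.prod_biUnion, ← Finset.prod_union]
  · congr 1
    ext m
    simp only [Finset.mem_union, Finset.mem_biUnion, Finset.mem_univ, true_and]
    constructor
    · rintro (⟨j, hj⟩ | h)
      · obtain ⟨k, hk, rfl⟩ := Finset.mem_image.1 hj
        exact Finset.mem_range.2 ((lt_progressionCount_iff (hq j)).1 (Finset.mem_range.1 hk))
      · exact hN h
    · intro hm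
      by_cases h : m ∈ F
      · exact .inr h
      · rw [hF, not_not] at h
        obtain ⟨j, k, rfl⟩ := h
        refine .inl ⟨j, Finset.mem_image.2 ⟨k, ?_, rfl⟩⟩
        exact Finset.mem_range.2 ((lt_progressionCount_iff (hq j)).2 (Finset.mem_range.1 hm))
  · rw [Finset.disjoint_left]
    intro m hm hmF
    obtain ⟨j, -, hj⟩ := Finset.mem_biUnion.1 hm
    obtain ⟨k, -, rfl⟩ := Finset.mem_image.1 hj
    exact (hF _).1 hmF ⟨j, k, rfl⟩
  · intro i _ j _ hij
    rw [Function.onFun, Finset.disjoint_left]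
    intro m hi hj
    obtain ⟨k, -, rfl⟩ := Finset.mem_image.1 hi
    obtain ⟨l, -, h⟩ := Finset.mem_image.1 hj
    exact hdisj i j hij k l h.symm

lemma prod_GammaSeq_progression {ι : Type*} [Fintype ι] {a q : ι → ℕ}
    (hq : ∀ j, 0 < q j) (hsum : ∑ j, (1 : ℂ) / q j = 1)
    (hdisj : ∀ i j, i ≠ j → ∀ k l, a i + q i * k ≠ a j + q j * l)
    {F : Finset ℕ} (hF : ∀ m, m ∈ F ↔ ¬ ∃ j k, m = a j + q j * k) {n : ℕ}
    (hN : F ⊆ Finset.range (n + 1)) (hn : n ≠ 0) (c : ι → ℕ) (hc0 : ∀ j, c j ≠ 0)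
    (hc : ∀ j, progressionCount (a j) (q j) (n + 1) = c j + 1)
    {s : ℂ} (hs : ¬ ∃ m : ℕ, s = -(m : ℂ)) :
    ∏ j, Complex.GammaSeq ((s + a j) / q j) (c j) =
      (∏ m ∈ F, (s + m)) * Complex.GammaSeq s n *
        ((∏ j, ((c j : ℂ) ^ ((a j : ℂ) / q j) * (c j).factorial * (q j : ℂ) ^ (c j + 1))) /
          n.factorial) *
        ∏ j, (((c j : ℝ) / n : ℝ) : ℂ) ^ (s / q j) := by
  have hs' : ∀ m : ℕ, s + m ≠ 0 := fun m h => hs ⟨m, eq_neg_of_add_eq_zero_left h⟩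
  have hn' : (n : ℂ) ≠ 0 := by exact_mod_cast hn
  have hqC : ∀ j, (q j : ℂ) ≠ 0 := fun j => by exact_mod_cast (hq j).ne'
  have hprod := prod_progression_mul_prod_compl hq hdisj hF (fun m : ℕ => s + (m : ℂ)) hN
  have hterm : ∀ j, Complex.GammaSeq ((s + a j) / q j) (c j) =
      ((c j : ℂ) ^ ((a j : ℂ) / q j) * (c j).factorial * (q j : ℂ) ^ (c j + 1)) *
        ((c j : ℂ) ^ (s / q j)) / ∏ k ∈ Finset.range (c j + 1), (s + ((a j + q j * k : ℕ) : ℂ)) := by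
    intro j
    have h1 : ∏ k ∈ Finset.range (c j + 1), (s + ((a j + q j * k : ℕ) : ℂ)) =
        (q j : ℂ) ^ (c j + 1) * ∏ k ∈ Finset.range (c j + 1), ((s + a j) / q j + k) := by
      conv_rhs => rw [← Finset.card_range (c j + 1), ← Finset.prod_const]
      rw [Finset.card_range, ← Finset.prod_mul_distrib]
      refine Finset.prod_congr rfl fun k _ => ?_
      have := hqC j
      push_cast
      field_simp
      ring
    have h2 : (q j : ℂ) ^ (c j + 1) ≠ 0 := pow_ne_zero _ (hqC j)
    rw [h1, Complex.GammaSeq, add_div, Complex.cpow_add _ _ (by exact_mod_cast hc0 j)]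
    rw [mul_right_comm _ ((q j : ℂ) ^ (c j + 1)), mul_comm ((q j : ℂ) ^ (c j + 1)),
      mul_div_mul_right _ _ h2]
    ring
  have hratio : ∏ j, (((c j : ℝ) / n : ℝ) : ℂ) ^ (s / q j) =
      (∏ j, (c j : ℂ) ^ (s / q j)) / (n : ℂ) ^ s := by
    have h1 : (n : ℂ) ^ s = ∏ j, (n : ℂ) ^ (s / q j) := by
      simp only [Complex.cpow_def_of_ne_zero hn']
      rw [← Complex.exp_sum, ← Finset.mul_sum]
      simp only [div_eq_mul_one_div s]
      rw [← Finset.mul_sum, hsum, mul_one]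
    rw [h1, ← Finset.prod_div_distrib]
    refine Finset.prod_congr rfl fun j _ => ?_
    have h2 : (((c j : ℝ) / n : ℝ) : ℂ) * (n : ℂ) = c j := by
      push_cast; field_simp
    have h3 : (n : ℂ) ^ (s / q j) ≠ 0 := by simp [Complex.cpow_eq_zero_iff, hn']
    rw [eq_div_iff h3, ← h2]
    have := Complex.mul_cpow_ofReal_nonneg (a := (c j : ℝ) / n) (b := n) (by positivity)
      (by positivity) (s / q j)
    simpa using this.symm
  have hne : ∏ m ∈ F, (s + (m : ℂ)) ≠ 0 := Finset.prod_ne_zero_iff.2 fun m _ => hs' m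
  have hne2 : ∏ j, ∏ k ∈ Finset.range (c j + 1), (s + ((a j + q j * k : ℕ) : ℂ)) ≠ 0 :=
    Finset.prod_ne_zero_iff.2 fun j _ => Finset.prod_ne_zero_iff.2 fun k _ => hs' _
  have hns : (n : ℂ) ^ s ≠ 0 := by simp [Complex.cpow_eq_zero_iff, hn']
  have hfac : (n.factorial : ℂ) ≠ 0 := by exact_mod_cast n.factorial_ne_zero
  simp only [hc] at hprod
  rw [Finset.prod_congr rfl fun j _ => hterm j, Finset.prod_div_distrib, Finset.prod_mul_distrib,
    hratio, Complex.GammaSeq, ← hprod]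
  generalize (∏ j, ((c j : ℂ) ^ ((a j : ℂ) / q j) * (c j).factorial * (q j : ℂ) ^ (c j + 1))) = X
  field_simp

lemma ofReal_cpow_eq_exp {x : ℝ} (hx : 0 < x) (s : ℂ) :
    (x : ℂ) ^ s = Complex.exp (Real.log x * s) := by
  rw [Complex.cpow_def_of_ne_zero (by exact_mod_cast hx.ne'), Complex.ofReal_log hx.le]

/-- A Gauss-type multiplication formula: if the progressions `a j + q j * ℕ` are disjoint with
union the complement of the finite set `F`, then `∏ Γ((s + a j) / q j)` is
`C e^{L s} Γ(s) ∏_{m ∈ F} (s + m)` with `C > 0` and `L` real. -/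
lemma exists_prod_Gamma_progression {ι : Type*} [Fintype ι] {a q : ι → ℕ}
    (hq : ∀ j, 0 < q j) (hsum : ∑ j, (1 : ℂ) / q j = 1)
    (hdisj : ∀ i j, i ≠ j → ∀ k l, a i + q i * k ≠ a j + q j * l)
    {F : Finset ℕ} (hF : ∀ m, m ∈ F ↔ ¬ ∃ j k, m = a j + q j * k) :
    ∃ C L : ℝ, 0 < C ∧ ∀ s : ℂ, (¬ ∃ m : ℕ, s = -(m : ℂ)) →
      ∏ j, Complex.Gamma ((s + a j) / q j) =
        C * Complex.exp (L * s) * Complex.Gamma s * ∏ m ∈ F, (s + m) := by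
  have hqR : ∀ j, (0 : ℝ) < q j := fun j => by exact_mod_cast hq j
  let c : ι → ℕ → ℕ := fun j n => progressionCount (a j) (q j) (n + 1) - 1
  let D : ℕ → ℂ := fun n => (∏ j, ((c j n : ℂ) ^ ((a j : ℂ) / q j) * (c j n).factorial *
    (q j : ℂ) ^ (c j n + 1))) / n.factorial
  let L : ℝ := ∑ j, Real.log (1 / q j) * (1 / q j)
  have hratio : ∀ s : ℂ, Filter.Tendsto
      (fun n : ℕ => ∏ j, (((c j n : ℝ) / n : ℝ) : ℂ) ^ (s / q j)) Filter.atTop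
      (nhds (Complex.exp (L * s))) := by
    intro s
    have h1 : Complex.exp (L * s) = ∏ j, ((1 / q j : ℝ) : ℂ) ^ (s / q j) := by
      rw [Finset.prod_congr rfl fun j _ => ofReal_cpow_eq_exp (one_div_pos.2 (hqR j)) (s / q j),
        ← Complex.exp_sum]
      congr 1
      simp only [L]
      rw [Complex.ofReal_sum, Finset.sum_mul]
      refine Finset.sum_congr rfl fun j _ => ?_
      push_cast
      ring
    rw [h1]
    refine tendsto_finsetProd _ fun j _ => ?_
    have h2 := (Complex.continuous_ofReal.tendsto _).comp
      (tendsto_progressionCount_sub_one_div (a j) (hq j))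
    refine Filter.Tendsto.cpow h2 tendsto_const_nhds ?_
    exact Complex.ofReal_mem_slitPlane.2 (one_div_pos.2 (hqR j))
  have hctop : ∀ j, Filter.Tendsto (c j) Filter.atTop Filter.atTop := by
    intro j
    rw [Filter.tendsto_atTop]
    intro b
    filter_upwards [Filter.eventually_ge_atTop (a j + q j * b)] with n hn
    have := (lt_progressionCount_iff (a := a j) (N := n + 1) (k := b) (hq j)).2 (by omega)
    simp only [c]
    omega
  have heq : ∀ s : ℂ, (¬ ∃ m : ℕ, s = -(m : ℂ)) → ∀ᶠ n in Filter.atTop,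
      ∏ j, Complex.GammaSeq ((s + a j) / q j) (c j n) =
        (∏ m ∈ F, (s + m)) * Complex.GammaSeq s n * D n *
          ∏ j, (((c j n : ℝ) / n : ℝ) : ℂ) ^ (s / q j) := by
    intro s hs
    have h1 : ∀ᶠ n in Filter.atTop, ∀ j, 1 ≤ c j n :=
      Filter.eventually_all.2 fun j => (hctop j).eventually_ge_atTop 1
    filter_upwards [h1, Filter.eventually_gt_atTop (F.sup id)] with n hn hF'
    refine prod_GammaSeq_progression hq hsum hdisj hF ?_ (by omega) (fun j => c j n)
      (fun j => by have := hn j; omega) (fun j => ?_) hs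
    · intro m hm
      have : m ≤ F.sup id := Finset.le_sup (f := id) hm
      exact Finset.mem_range.2 (by omega)
    · have := hn j
      simp only [c] at this ⊢
      omega
  have hlhs : ∀ s : ℂ, Filter.Tendsto
      (fun n => ∏ j, Complex.GammaSeq ((s + a j) / q j) (c j n)) Filter.atTop
      (nhds (∏ j, Complex.Gamma ((s + a j) / q j))) := fun s =>
    tendsto_finsetProd _ fun j _ => (Complex.GammaSeq_tendsto_Gamma _).comp (hctop j)
  have hrhs : ∀ s : ℂ, Filter.Tendsto (fun n => (∏ m ∈ F, (s + m)) * Complex.GammaSeq s n *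
      ∏ j, (((c j n : ℝ) / n : ℝ) : ℂ) ^ (s / q j)) Filter.atTop
      (nhds ((∏ m ∈ F, (s + m)) * Complex.Gamma s * Complex.exp (L * s))) := fun s =>
    (tendsto_const_nhds.mul (Complex.GammaSeq_tendsto_Gamma s)).mul (hratio s)
  have hne : ∀ s : ℂ, (¬ ∃ m : ℕ, s = -(m : ℂ)) →
      (∏ m ∈ F, (s + m)) * Complex.Gamma s * Complex.exp (L * s) ≠ 0 := by
    intro s hs
    refine mul_ne_zero (mul_ne_zero (Finset.prod_ne_zero_iff.2 fun m _ h =>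
      hs ⟨m, eq_neg_of_add_eq_zero_left h⟩) ?_) (Complex.exp_ne_zero _)
    exact Complex.Gamma_ne_zero fun m h => hs ⟨m, h⟩
  have hD : ∀ s : ℂ, (¬ ∃ m : ℕ, s = -(m : ℂ)) → Filter.Tendsto D Filter.atTop
      (nhds ((∏ j, Complex.Gamma ((s + a j) / q j)) /
        ((∏ m ∈ F, (s + m)) * Complex.Gamma s * Complex.exp (L * s)))) := by
    intro s hs
    refine ((hlhs s).div (hrhs s) (hne s hs)).congr' ?_
    filter_upwards [heq s hs, (hrhs s).eventually_ne (hne s hs)] with n hn hn0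
    rw [Pi.div_apply, hn, div_eq_iff hn0]
    ring
  have h1 : ¬ ∃ m : ℕ, (1 : ℂ) = -(m : ℂ) := by
    rintro ⟨m, hm⟩
    have : (1 : ℤ) = -(m : ℤ) := by exact_mod_cast hm
    omega
  refine ⟨(∏ j, Real.Gamma ((1 + a j) / q j)) / ((∏ m ∈ F, (1 + m : ℝ)) * Real.exp L), L, ?_, ?_⟩
  · refine div_pos (Finset.prod_pos fun j _ => Real.Gamma_pos_of_pos ?_)
      (mul_pos (Finset.prod_pos fun m _ => by positivity) (Real.exp_pos L))
    exact div_pos (by positivity) (hqR j)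
  · intro s hs
    have h2 := tendsto_nhds_unique (hD s hs) (hD 1 h1)
    rw [div_eq_iff (hne s hs)] at h2
    rw [h2]
    push_cast [← Complex.Gamma_ofReal]
    rw [Complex.Gamma_one, mul_one, mul_one]
    ring

lemma exists_progressions_of_cofinite_isGammaPole {ι : Type*} [Fintype ι] {lam : ι → ℝ}
    {mu : ι → ℂ} (hlam : ∀ j, 0 < lam j) (hmu : ∀ j, -(lam j) / 2 < (mu j).re)
    (hsum : ∑ j, lam j = 1) (hfin : {m : ℕ | ¬ ∃ j, IsGammaPole (lam j) (mu j) m}.Finite) :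
    ∃ q a : ι → ℕ, (∀ j, 0 < q j) ∧ (∀ j, lam j = 1 / q j) ∧ (∀ j, mu j = a j / q j) ∧
      (∀ i j, i ≠ j → ∀ k l, a i + q i * k ≠ a j + q j * l) ∧
      ∀ j m, IsGammaPole (lam j) (mu j) m ↔ ∃ k, m = a j + q j * k := by
  classical
  have hp := fun j => card_filter_isGammaPole_le (hlam j) (hmu j)
  have hqa : ∀ j, ∃ q a : ℕ, 0 < q ∧ lam j = 1 / q ∧ mu j = a / q := by
    intro i
    obtain ⟨C, hC⟩ := exists_le_card_filter_of_cover hsum hp i (IsGammaPole (lam i) (mu i))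
      (hfin.subset fun m hm ⟨j, hj⟩ => hm <| by
        by_cases h : j = i
        · exact .inl (h ▸ hj)
        · exact .inr ⟨j, h, hj⟩)
    exact exists_eq_natCast_div_of_le_card (hlam i) (hmu i) hC
  choose q a hq hl hu using hqa
  have hiff : ∀ j m, IsGammaPole (lam j) (mu j) m ↔ ∃ k, m = a j + q j * k := by
    intro j m
    have hqC : (q j : ℂ) ≠ 0 := by exact_mod_cast (hq j).ne'
    refine exists_congr fun k => ?_
    rw [hl, hu]
    push_cast
    rw [← Nat.cast_inj (R := ℂ)]
    push_cast
    field_simp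
    constructor <;> intro h <;> linear_combination -h
  refine ⟨q, a, hq, hl, hu, ?_, hiff⟩
  intro i j hij k l hkl
  have hinter : ∀ t, IsGammaPole (lam i) (mu i) (a i + q i * k + q i * q j * t) ∧
      IsGammaPole (lam j) (mu j) (a i + q i * k + q i * q j * t) := fun t =>
    ⟨(hiff i _).2 ⟨k + q j * t, by ring⟩, (hiff j _).2 ⟨l + q i * t, by rw [hkl]; ring⟩⟩
  obtain ⟨C, hC⟩ := exists_le_card_filter_of_cover hsum hp i
    (fun m => IsGammaPole (lam i) (mu i) m ∧ ¬ IsGammaPole (lam j) (mu j) m)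
    (hfin.subset fun m hm ⟨j', hj'⟩ => hm <| by
      by_cases h : IsGammaPole (lam j) (mu j) m
      · exact .inr ⟨j, hij.symm, h⟩
      · by_cases h' : j' = i
        · exact .inl ⟨h' ▸ hj', h⟩
        · exact .inr ⟨j', h', hj'⟩)
  obtain ⟨T, hT⟩ := exists_nat_gt (C + 1)
  set N := a i + q i * k + q i * q j * T with hN
  have hTle : (Finset.range T).card ≤ ((Finset.range N).filter
      fun m => IsGammaPole (lam i) (mu i) m ∧ IsGammaPole (lam j) (mu j) m).card := by
    have hqq : 0 < q i * q j := Nat.mul_pos (hq i) (hq j)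
    refine Finset.card_le_card_of_injOn (fun t => a i + q i * k + q i * q j * t) ?_ ?_
    · intro t ht
      have ht' : t < T := by simpa using ht
      exact Finset.mem_coe.2 (Finset.mem_filter.2 ⟨Finset.mem_range.2
        (Nat.add_lt_add_left (Nat.mul_lt_mul_of_pos_left ht' hqq) _), hinter t⟩)
    · intro t _ t' _ h
      exact Nat.eq_of_mul_eq_mul_left hqq (Nat.add_left_cancel h)
  rw [Finset.card_range] at hTle
  have hsplit := Finset.card_filter_add_card_filter_not
    (s := (Finset.range N).filter (IsGammaPole (lam i) (mu i)))
    (IsGammaPole (lam j) (mu j))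
  rw [Finset.filter_filter, Finset.filter_filter] at hsplit
  have h1 : lam i * N - C ≤ (((Finset.range N).filter fun m =>
      IsGammaPole (lam i) (mu i) m ∧ ¬ IsGammaPole (lam j) (mu j) m).card : ℝ) := by
    convert hC N
  have h2 := hp i N
  rw [← hsplit] at h2
  push_cast at h2
  have h3 : (T : ℝ) ≤ ((Finset.range N).filter
      fun m => IsGammaPole (lam i) (mu i) m ∧ IsGammaPole (lam j) (mu j) m).card := by
    exact_mod_cast hTle
  linarith

/-- If `γ(s) = Q^s ∏_j Γ(λ_j s + μ_j)` (with `Q, λ_j > 0`, `Re μ_j > -λ_j/2`, `Σ λ_j = 1`)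
has poles at all but finitely many nonpositive integers, then
`γ(s) = C · P(s) · H^s · Γ_ℂ(s)` with `C, H > 0` and `P` a monic polynomial whose roots
are distinct nonpositive integers.  (Since `Γ` never vanishes, `γ` has a pole at `z`
precisely when some `λ_j z + μ_j` is a nonpositive integer.) -/
theorem gamma_factor_classification (r : ℕ) (Q : ℝ) (lam : Fin r → ℝ) (mu : Fin r → ℂ)
    (hQ : 0 < Q) (hlam : ∀ j, 0 < lam j) (hmu : ∀ j, -(lam j) / 2 < (mu j).re)
    (hsum : ∑ j, lam j = 1)
    (γ : ℂ → ℂ)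
    (hγ : ∀ s : ℂ, γ s = ((Q : ℂ) ^ s) * ∏ j, Complex.Gamma ((lam j : ℂ) * s + mu j))
    (hpoles : {m : ℕ | ¬ ∃ j : Fin r, ∃ k : ℕ,
        (lam j : ℂ) * (-(m : ℂ)) + mu j = -(k : ℂ)}.Finite) :
    ∃ C H : ℝ, 0 < C ∧ 0 < H ∧ ∃ P : Polynomial ℂ, P.Monic ∧
      (∀ z ∈ P.roots, ∃ m : ℕ, z = -(m : ℂ)) ∧ P.roots.Nodup ∧
      ∀ s : ℂ, (¬ ∃ m : ℕ, s = -(m : ℂ)) →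
        γ s = (C : ℂ) * P.eval s * ((H : ℝ) : ℂ) ^ s * GammaC s := by
  obtain ⟨q, a, hq, hl, hu, hdisj, hiff⟩ :=
    exists_progressions_of_cofinite_isGammaPole hlam hmu hsum hpoles
  have hF : ∀ m, m ∈ hpoles.toFinset ↔ ¬ ∃ j k, m = a j + q j * k := by
    intro m
    rw [hpoles.mem_toFinset]
    exact not_congr (exists_congr fun j => hiff j m)
  have hsumC : ∑ j, (1 : ℂ) / q j = 1 := by
    have h := congrArg (fun x : ℝ => (x : ℂ)) hsum
    simpa [hl] using h
  obtain ⟨C, L, hC, hmain⟩ := exists_prod_Gamma_progression hq hsumC hdisj hF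
  let roots : Multiset ℂ := hpoles.toFinset.val.map fun m : ℕ => -(m : ℂ)
  have hroots : (roots.map fun z => Polynomial.X - Polynomial.C z).prod.roots = roots :=
    Polynomial.roots_multiset_prod_X_sub_C _
  refine ⟨C / 2, Real.exp (Real.log Q + L + Real.log (2 * Real.pi)), by positivity,
    Real.exp_pos _, (roots.map fun z => Polynomial.X - Polynomial.C z).prod,
    Polynomial.monic_multiset_prod_of_monic _ _ fun z _ => Polynomial.monic_X_sub_C z, ?_, ?_, ?_⟩
  · rw [hroots]
    intro z hz
    obtain ⟨m, -, rfl⟩ := Multiset.mem_map.1 hz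
    exact ⟨m, rfl⟩
  · rw [hroots]
    exact hpoles.toFinset.nodup.map fun m n h => by simpa using h
  · intro s hs
    have hP : (roots.map fun z => Polynomial.X - Polynomial.C z).prod.eval s =
        ∏ m ∈ hpoles.toFinset, (s + m) := by
      rw [Polynomial.eval_multiset_prod, Multiset.map_map, Multiset.map_map]
      simp [Function.comp_def]
    have hG : ∏ j, Complex.Gamma ((lam j : ℂ) * s + mu j) =
        ∏ j, Complex.Gamma ((s + a j) / q j) := by
      refine Finset.prod_congr rfl fun j _ => ?_
      rw [hl, hu]
      push_cast
      ring_nf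
    rw [hγ, hG, hmain s hs, hP, GammaC, ofReal_cpow_eq_exp hQ,
      ofReal_cpow_eq_exp (Real.exp_pos _), Real.log_exp,
      ofReal_cpow_eq_exp Real.two_pi_pos, mul_neg, Complex.exp_neg]
    push_cast
    rw [add_mul, add_mul, Complex.exp_add, Complex.exp_add]
    have := Complex.exp_ne_zero ((Real.log (2 * Real.pi) : ℝ) * s)
    field_simp
end

section
/- Let λ > 1 be real. The function f_λ(y) = (1/√(1-y²))·cos(λ·arccos(y)) for y ∈ (0,1) and f_λ(y) = 0 otherwise has Mellin transform ∫_0^∞ f_λ(y) y^{s-1} dy = Γ_ℂ(s) / (2^s · Γ_ℂ((s+λ+1)/2) · Γ_ℂ((s-λ+1)/2)) for Re(s) > 0. -/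
open scoped Real

open MeasureTheory Set Filter Topology

/-- The cosine-power integral `∫ cos^{s-1} θ cos (λθ) dθ` over `(0, π/2)`. -/
noncomputable def cosPowerIntegral (lam : ℝ) (s : ℂ) : ℂ :=
  ∫ x in Ioo (0 : ℝ) (π / 2), (Real.cos x : ℂ) ^ (s - 1) * (Real.cos (lam * x) : ℂ)

lemma cos_pos_of_mem_Ioo_zero_pi_div_two {x : ℝ} (hx : x ∈ Ioo (0 : ℝ) (π / 2)) :
    0 < Real.cos x :=
  Real.cos_pos_of_mem_Ioo ⟨by linarith [hx.1, Real.pi_pos], hx.2⟩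

lemma integrableOn_cos_cpow {s : ℂ} (hs : 0 < s.re) :
    IntegrableOn (fun x : ℝ => (Real.cos x : ℂ) ^ (s - 1)) (Ioo 0 (π / 2)) := by
  have h1 : IntegrableOn (fun x : ℝ => (1 - 2 / π * x) ^ (s.re - 1)) (Ioo 0 (π / 2)) := by
    have h := intervalIntegral.intervalIntegrable_rpow' (a := 1) (b := 0) (r := s.re - 1)
      (by linarith)
    have h2 := (h.comp_sub_left 1).comp_mul_left (c := 2 / π)
    have hpi : (1 : ℝ) / (2 / π) = π / 2 := by field_simp
    simp only [sub_self, sub_zero, zero_div, hpi] at h2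
    rw [intervalIntegrable_iff_integrableOn_Ioo_of_le (by positivity)] at h2
    exact h2
  have h2 : IntegrableOn (fun _ : ℝ => (1 : ℝ)) (Ioo 0 (π / 2)) := by simp
  refine Integrable.mono' (h1.add h2) ?_ ?_
  · exact (by fun_prop : Measurable fun x : ℝ => (Real.cos x : ℂ) ^ (s - 1)).aestronglyMeasurable
  · filter_upwards [self_mem_ae_restrict measurableSet_Ioo] with x hx
    have hc := cos_pos_of_mem_Ioo_zero_pi_div_two hx
    rw [Complex.norm_cpow_eq_rpow_re_of_pos hc]
    have hj := Real.one_sub_mul_le_cos hx.1.le hx.2.le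
    have hj0 : 0 < 1 - 2 / π * x := by
      have := mul_lt_mul_of_pos_left hx.2 (by positivity : 0 < 2 / π)
      field_simp at this ⊢
      linarith
    simp only [Complex.sub_re, Complex.one_re, Pi.add_apply]
    rcases le_total (s.re - 1) 0 with h | h
    · exact (Real.rpow_le_rpow_of_nonpos hj0 hj h).trans (by simp)
    · exact (Real.rpow_le_one hc.le (Real.cos_le_one x) h).trans
        (by simpa using Real.rpow_nonneg hj0.le _)

lemma integrableOn_cos_cpow_mul_cos (lam : ℝ) {s : ℂ} (hs : 0 < s.re) :
    IntegrableOn (fun x : ℝ => (Real.cos x : ℂ) ^ (s - 1) * (Real.cos (lam * x) : ℂ))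
      (Ioo 0 (π / 2)) := by
  refine Integrable.mul_bdd (c := 1) (integrableOn_cos_cpow hs) ?_ ?_
  · exact (by fun_prop : Measurable fun x : ℝ => (Real.cos (lam * x) : ℂ)).aestronglyMeasurable
  · filter_upwards with x
    rw [Complex.norm_real, Real.norm_eq_abs]
    exact Real.abs_cos_le_one _

lemma cosPowerIntegral_recurrence (lam : ℝ) {s : ℂ} (hs : 0 < s.re) :
    s * (s + 1) * cosPowerIntegral lam s =
      (s + 1 + lam) * (s + 1 - lam) * cosPowerIntegral lam (s + 2) := by
  have hs0 : s ≠ 0 := fun h => by simp [h] at hs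
  have hs1 : s + 1 ≠ 0 := fun h => by
    have := congrArg Complex.re h
    simp at this
    linarith
  have hs2 : 0 < (s + 2).re := by simp; linarith
  set G : ℝ → ℂ := fun x => -lam * ((Real.cos x : ℂ) ^ (s + 1) * (Real.sin (lam * x) : ℂ)) +
    (s + 1) * ((Real.cos x : ℂ) ^ s * ((Real.sin x : ℂ) * (Real.cos (lam * x) : ℂ))) with hG
  set G' : ℝ → ℂ := fun x => s * (s + 1) *
      ((Real.cos x : ℂ) ^ (s - 1) * (Real.cos (lam * x) : ℂ)) - (s + 1 + lam) * (s + 1 - lam) *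
      ((Real.cos x : ℂ) ^ (s + 2 - 1) * (Real.cos (lam * x) : ℂ)) with hG'
  have hcont : Continuous fun x : ℝ => (Real.cos x : ℂ) ^ s :=
    (Complex.continuous_ofReal_cpow_const hs).comp Real.continuous_cos
  have hcont1 : Continuous fun x : ℝ => (Real.cos x : ℂ) ^ (s + 1) :=
    (Complex.continuous_ofReal_cpow_const (by simp; linarith)).comp Real.continuous_cos
  have hIntS := (integrableOn_cos_cpow_mul_cos lam hs).const_mul (s * (s + 1))
  have hIntS2 := (integrableOn_cos_cpow_mul_cos lam hs2).const_mul ((s + 1 + lam) * (s + 1 - lam))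
  have key := intervalIntegral.integral_eq_sub_of_hasDerivAt_of_le (f := G)
    (f' := fun x => -G' x) (a := 0) (b := π / 2)
    (by positivity) (by fun_prop) ?_ ?_
  · have h1 : G (π / 2) - G 0 = 0 := by simp [hG, hs0, hs1]
    rw [h1, intervalIntegral.integral_neg, neg_eq_zero,
      intervalIntegral.integral_of_le (by positivity), integral_Ioc_eq_integral_Ioo, hG',
      integral_sub hIntS hIntS2, integral_const_mul, integral_const_mul, sub_eq_zero] at key
    exact key
  · intro x hx
    have hc := cos_pos_of_mem_Ioo_zero_pi_div_two hx
    have hc' : (Real.cos x : ℂ) ≠ 0 := by exact_mod_cast hc.ne'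
    have hp (r : ℂ) (hr : r ≠ 0) : HasDerivAt (fun x : ℝ => (Real.cos x : ℂ) ^ r)
        ((-Real.sin x : ℝ) • (r * (Real.cos x : ℂ) ^ (r - 1))) x :=
      (hasDerivAt_ofReal_cpow_const hc.ne' hr).scomp x (Real.hasDerivAt_cos x)
    have hlin : HasDerivAt (fun x : ℝ => lam * x) lam x := by
      simpa using (hasDerivAt_id x).const_mul lam
    have hsinl := hlin.sin.ofReal_comp
    have hcosl := hlin.cos.ofReal_comp
    have hsin := (Real.hasDerivAt_sin x).ofReal_comp
    have hd := ((hp _ hs1).mul hsinl).const_mul (-lam : ℂ) |>.add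
      (((hp _ hs0).mul (hsin.mul hcosl)).const_mul (s + 1))
    convert! hd using 1
    have hcpow : (Real.cos x : ℂ) ^ s = (Real.cos x : ℂ) ^ (s - 1) * Real.cos x := by
      rw [Complex.cpow_sub _ _ hc', Complex.cpow_one, div_mul_cancel₀ _ hc']
    have hcpow_add_one : (Real.cos x : ℂ) ^ (s + 1) =
        (Real.cos x : ℂ) ^ (s - 1) * Real.cos x * Real.cos x := by
      rw [Complex.cpow_add _ _ hc', Complex.cpow_one, hcpow]
    have hexp : s + 2 - 1 = s + 1 := by ring
    have hsq : (Real.sin x : ℂ) ^ 2 = 1 - (Real.cos x : ℂ) ^ 2 := by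
      exact_mod_cast Real.sin_sq x
    simp only [hG', hexp, add_sub_cancel_right, hcpow, hcpow_add_one, Complex.real_smul,
      Complex.ofReal_mul, Complex.ofReal_neg, Pi.mul_apply]
    linear_combination (s + 1) * s * (Real.cos x : ℂ) ^ (s - 1) * Real.cos (lam * x) * hsq
  · rw [intervalIntegrable_iff_integrableOn_Ioo_of_le (by positivity)]
    exact (hIntS.sub hIntS2).neg

lemma prod_mul_cosPowerIntegral (lam : ℝ) {s : ℂ} (hs : 0 < s.re) (N : ℕ) :
    (∏ j ∈ Finset.range N, (s / 2 + j)) * (∏ j ∈ Finset.range N, (s / 2 + 1 / 2 + j)) *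
        cosPowerIntegral lam s =
      (∏ j ∈ Finset.range N, ((s + lam + 1) / 2 + j)) *
        (∏ j ∈ Finset.range N, ((s - lam + 1) / 2 + j)) *
        cosPowerIntegral lam (s + 2 * N) := by
  induction N with
  | zero => simp
  | succ N ih =>
    have h := cosPowerIntegral_recurrence lam (s := s + 2 * N) (by simp; positivity)
    have e : s + 2 * ((N + 1 : ℕ) : ℂ) = s + 2 * N + 2 := by push_cast; ring
    rw [e]
    simp only [Finset.prod_range_succ]
    linear_combination ((s / 2 + N) * (s / 2 + 1 / 2 + N)) * ih +
      (∏ j ∈ Finset.range N, ((s + lam + 1) / 2 + j)) *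
        (∏ j ∈ Finset.range N, ((s - lam + 1) / 2 + j)) / 4 * h

lemma tendsto_cos_div_sqrt_pow (u : ℝ) :
    Tendsto (fun n : ℕ => Real.cos (u / √n) ^ (2 * n)) atTop (𝓝 (Real.exp (-u ^ 2))) := by
  have hx : Tendsto (fun n : ℕ => u / √(n : ℝ)) atTop (𝓝 0) :=
    tendsto_const_nhds.div_atTop (Real.tendsto_sqrt_atTop.comp tendsto_natCast_atTop_atTop)
  have hsinc : Tendsto (fun n : ℕ => Real.sinc (u / √n)) atTop (𝓝 1) := by
    simpa [Function.comp_def] using (Real.continuous_sinc.tendsto 0).comp hx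
  have hg : Tendsto (fun n : ℕ => (n : ℝ) * -Real.sin (u / √n) ^ 2) atTop (𝓝 (-u ^ 2)) := by
    have h2 : Tendsto (fun n : ℕ => -(u ^ 2 * Real.sinc (u / √n) ^ 2)) atTop (𝓝 (-u ^ 2)) := by
      simpa using ((hsinc.pow 2).const_mul (u ^ 2)).neg
    refine h2.congr' ?_
    filter_upwards [eventually_gt_atTop 0] with n hn
    have hn' : (0 : ℝ) < n := by exact_mod_cast hn
    have hsq : √(n : ℝ) ^ 2 = n := Real.sq_sqrt hn'.le
    by_cases hu : u = 0
    · simp [hu]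
    · rw [Real.sinc_of_ne_zero (by positivity)]
      field_simp
      rw [hsq]
      ring
  refine (Real.tendsto_one_add_pow_exp_of_tendsto hg).congr fun n => ?_
  rw [pow_mul, Real.cos_sq']
  ring

lemma tendsto_sqrt_mul_cosPowerIntegral (lam : ℝ) {s : ℂ} (hs : 1 < s.re) :
    Tendsto (fun n : ℕ => (√n : ℂ) * cosPowerIntegral lam (s + 2 * n)) atTop
      (𝓝 ((√π / 2 : ℝ) : ℂ)) := by
  set F : ℕ → ℝ → ℂ := fun n => (Ioo 0 (π / 2)).indicator fun x =>
    (Real.cos x : ℂ) ^ (s + 2 * n - 1) * (Real.cos (lam * x) : ℂ) with hF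
  have hFapp (n : ℕ) {x : ℝ} (hx : x ∈ Ioo 0 (π / 2)) : F n x =
      (Real.cos x : ℂ) ^ (s - 1) * (Real.cos (lam * x) : ℂ) * ((Real.cos x ^ (2 * n) : ℝ) : ℂ) := by
    have hc : (Real.cos x : ℂ) ≠ 0 := by
      exact_mod_cast (cos_pos_of_mem_Ioo_zero_pi_div_two hx).ne'
    have e : s + 2 * n - 1 = (s - 1) + ((2 * n : ℕ) : ℂ) := by push_cast; ring
    simp only [hF, indicator_of_mem hx, e]
    rw [Complex.cpow_add _ _ hc, Complex.cpow_natCast]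
    push_cast
    ring
  have hscale : ∀ᶠ n : ℕ in atTop, ∫ u in Ioi (0 : ℝ), F n (u / √n) =
      (√n : ℂ) * cosPowerIntegral lam (s + 2 * n) := by
    filter_upwards [eventually_gt_atTop 0] with n hn
    have hn' : (0 : ℝ) < (√n)⁻¹ := by positivity
    have h := integral_comp_mul_left_Ioi (F n) 0 hn'
    simp only [mul_zero, inv_inv] at h
    simp only [← div_eq_inv_mul] at h
    rw [h, cosPowerIntegral, setIntegral_indicator measurableSet_Ioo, inter_eq_right.2 Ioo_subset_Ioi_self,
      Complex.real_smul]
  have hval : ∫ u in Ioi (0 : ℝ), ((Real.exp (-u ^ 2) : ℝ) : ℂ) = ((√π / 2 : ℝ) : ℂ) := by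
    rw [integral_complex_ofReal]
    have := integral_gaussian_Ioi 1
    simp only [neg_mul, one_mul, div_one] at this
    rw [← this]
  rw [← hval]
  refine Tendsto.congr' hscale ?_
  refine tendsto_integral_filter_of_dominated_convergence
    (fun u => Real.exp (-(4 / π ^ 2) * u ^ 2)) ?_ ?_
    (integrable_exp_neg_mul_sq (by positivity)).integrableOn ?_
  · filter_upwards with n
    have : Measurable (F n) := Measurable.indicator (by fun_prop) measurableSet_Ioo
    exact (this.comp (measurable_id.div_const _)).aestronglyMeasurable
  · filter_upwards [eventually_gt_atTop 0] with n hn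
    have hn' : (0 : ℝ) < n := by exact_mod_cast hn
    filter_upwards with u
    by_cases hx : u / √n ∈ Ioo 0 (π / 2)
    · have hc := cos_pos_of_mem_Ioo_zero_pi_div_two hx
      rw [hFapp n hx, norm_mul, norm_mul, Complex.norm_cpow_eq_rpow_re_of_pos hc,
        Complex.norm_real, Complex.norm_real,
        Real.norm_of_nonneg (r := Real.cos (u / √n) ^ (2 * n)) (by positivity)]
      have h1 : Real.cos (u / √n) ^ (s - 1).re ≤ 1 :=
        Real.rpow_le_one hc.le (Real.cos_le_one _) (by simp; linarith)
      have h2 : ‖Real.cos (lam * (u / √n))‖ ≤ 1 := Real.abs_cos_le_one _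
      have h3 : Real.cos (u / √n) ≤ Real.exp (-(2 / π ^ 2 * (u / √n) ^ 2)) := by
        refine (Real.cos_le_one_sub_mul_cos_sq ?_).trans (Real.one_sub_le_exp_neg _)
        rw [abs_of_pos hx.1]
        linarith [hx.2, Real.pi_pos]
      calc _ ≤ 1 * 1 * Real.exp (-(2 / π ^ 2 * (u / √n) ^ 2)) ^ (2 * n) := by gcongr
        _ = _ := by
          rw [← Real.exp_nat_mul, div_pow, Real.sq_sqrt hn'.le, one_mul, one_mul]
          congr 1
          push_cast
          field_simp
          ring
    · rw [hF]
      simp only [indicator_of_notMem hx, norm_zero]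
      positivity
  · filter_upwards [self_mem_ae_restrict measurableSet_Ioi] with u hu
    have hu : 0 < u := hu
    have hx : Tendsto (fun n : ℕ => u / √(n : ℝ)) atTop (𝓝 0) :=
      tendsto_const_nhds.div_atTop (Real.tendsto_sqrt_atTop.comp tendsto_natCast_atTop_atTop)
    have hcos : ContinuousAt (fun x : ℝ => (Real.cos x : ℂ) ^ (s - 1) *
        (Real.cos (lam * x) : ℂ)) 0 := by
      have : Continuous fun x : ℝ => (Real.cos x : ℂ) ^ (s - 1) :=
        (Complex.continuous_ofReal_cpow_const (by simpa using hs)).comp Real.continuous_cos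
      fun_prop
    have h1 := (hcos.tendsto.comp hx).mul
      ((Complex.continuous_ofReal.tendsto _).comp (tendsto_cos_div_sqrt_pow u))
    simp only [Real.cos_zero, mul_zero, Complex.ofReal_one, Complex.one_cpow, one_mul] at h1
    refine h1.congr' ?_
    filter_upwards [hx.eventually_lt_const (by positivity : 0 < π / 2), eventually_gt_atTop 0]
      with n hn hn0
    exact (hFapp n ⟨by positivity, hn⟩).symm

lemma prod_add_natCast_ne_zero {z : ℂ} (hz : ∀ m : ℕ, z ≠ -m) (n : ℕ) :
    ∏ j ∈ Finset.range n, (z + j) ≠ 0 :=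
  Finset.prod_ne_zero_iff.2 fun j _ h => hz j (eq_neg_of_add_eq_zero_left h)

lemma ne_neg_natCast_of_re_pos {z : ℂ} (hz : 0 < z.re) (m : ℕ) : z ≠ -m := fun h => by
  have := congrArg Complex.re h
  simp at this
  linarith [(Nat.cast_nonneg m : (0 : ℝ) ≤ m)]

lemma cosPowerIntegral_eq_Gamma (lam : ℝ) {s : ℂ} (hs : 0 < s.re) :
    cosPowerIntegral lam s = π * Complex.Gamma s /
      (2 ^ s * Complex.Gamma ((s + lam + 1) / 2) * Complex.Gamma ((s - lam + 1) / 2)) := by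
  have hc : ∀ m : ℕ, s / 2 ≠ -m := ne_neg_natCast_of_re_pos (by simpa using hs)
  have hd : ∀ m : ℕ, s / 2 + 1 / 2 ≠ -m := ne_neg_natCast_of_re_pos (by
    rw [show s / 2 + 1 / 2 = (s + 1) / 2 by ring, Complex.div_ofNat_re]; simp; linarith)
  by_cases ha : ∀ m : ℕ, (s + lam + 1) / 2 ≠ -m
  swap
  · push Not at ha
    obtain ⟨m, hm⟩ := ha
    have h := prod_mul_cosPowerIntegral lam hs (m + 1)
    rw [Finset.prod_range_succ (fun j : ℕ => (s + lam + 1) / 2 + j), hm, neg_add_cancel, mul_zero,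
      zero_mul, zero_mul] at h
    rw [hm, Complex.Gamma_neg_nat_eq_zero]
    rw [mul_zero, zero_mul, div_zero]
    exact (mul_eq_zero.1 h).resolve_left (mul_ne_zero (prod_add_natCast_ne_zero hc _)
      (prod_add_natCast_ne_zero hd _))
  by_cases hb : ∀ m : ℕ, (s - lam + 1) / 2 ≠ -m
  swap
  · push Not at hb
    obtain ⟨m, hm⟩ := hb
    have h := prod_mul_cosPowerIntegral lam hs (m + 1)
    rw [Finset.prod_range_succ (fun j : ℕ => (s - lam + 1) / 2 + j), hm, neg_add_cancel, mul_zero,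
      mul_zero, zero_mul] at h
    rw [hm, Complex.Gamma_neg_nat_eq_zero]
    rw [mul_zero, div_zero]
    exact (mul_eq_zero.1 h).resolve_left (mul_ne_zero (prod_add_natCast_ne_zero hc _)
      (prod_add_natCast_ne_zero hd _))
  have hGa := Complex.Gamma_ne_zero ha
  have hGb := Complex.Gamma_ne_zero hb
  have hlim := (((Complex.GammaSeq_tendsto_Gamma (s / 2)).mul
    (Complex.GammaSeq_tendsto_Gamma (s / 2 + 1 / 2))).div
    ((Complex.GammaSeq_tendsto_Gamma ((s + lam + 1) / 2)).mul
      (Complex.GammaSeq_tendsto_Gamma ((s - lam + 1) / 2))) (mul_ne_zero hGa hGb)).mul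
    (tendsto_sqrt_mul_cosPowerIntegral lam (s := s + 2) (by simp; linarith))
  have hconst := (hlim.congr' (f₂ := fun _ => cosPowerIntegral lam s) ?_)
  · rw [tendsto_nhds_unique tendsto_const_nhds hconst, Complex.Gamma_mul_Gamma_add_half,
      mul_div_cancel₀ s two_ne_zero, Complex.cpow_sub _ _ two_ne_zero, Complex.cpow_one]
    have h2 : (2 : ℂ) ^ s ≠ 0 := by simp [Complex.cpow_eq_zero_iff]
    have hpi : ((√π : ℝ) : ℂ) * ((√π : ℝ) : ℂ) = π := by
      exact_mod_cast Real.mul_self_sqrt Real.pi_pos.le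
    rw [← hpi]
    push_cast
    field_simp
  · filter_upwards [eventually_gt_atTop 0] with n hn
    have hn' : (n : ℂ) ≠ 0 := by exact_mod_cast hn.ne'
    have h := prod_mul_cosPowerIntegral lam hs (n + 1)
    have e : s + 2 * ((n + 1 : ℕ) : ℂ) = s + 2 + 2 * n := by push_cast; ring
    rw [e] at h
    have pa := prod_add_natCast_ne_zero ha (n + 1)
    have pb := prod_add_natCast_ne_zero hb (n + 1)
    have pc := prod_add_natCast_ne_zero hc (n + 1)
    have pd := prod_add_natCast_ne_zero hd (n + 1)
    have hsqrt : ((√(n : ℝ) : ℝ) : ℂ) = (n : ℂ) ^ (1 / 2 : ℂ) := by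
      rw [Real.sqrt_eq_rpow, Complex.ofReal_cpow (by positivity)]
      simp
    have hpow : (n : ℂ) ^ (s / 2) * (n : ℂ) ^ (s / 2 + 1 / 2) * (n : ℂ) ^ (1 / 2 : ℂ) =
        (n : ℂ) ^ ((s + lam + 1) / 2) * (n : ℂ) ^ ((s - lam + 1) / 2) := by
      rw [← Complex.cpow_add _ _ hn', ← Complex.cpow_add _ _ hn', ← Complex.cpow_add _ _ hn']
      congr 1
      ring
    have hpa : (n : ℂ) ^ ((s + lam + 1) / 2) ≠ 0 := by simp [Complex.cpow_eq_zero_iff, hn']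
    have hpb : (n : ℂ) ^ ((s - lam + 1) / 2) ≠ 0 := by simp [Complex.cpow_eq_zero_iff, hn']
    have hf : ((n.factorial : ℕ) : ℂ) ≠ 0 := by exact_mod_cast n.factorial_ne_zero
    simp only [Pi.div_apply, Complex.GammaSeq, hsqrt]
    generalize (∏ j ∈ Finset.range (n + 1), ((s + lam + 1) / 2 + (j : ℂ))) = A at *
    generalize (∏ j ∈ Finset.range (n + 1), ((s - lam + 1) / 2 + (j : ℂ))) = B at *
    generalize (∏ j ∈ Finset.range (n + 1), (s / 2 + (j : ℂ))) = C at *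
    generalize (∏ j ∈ Finset.range (n + 1), (s / 2 + 1 / 2 + (j : ℂ))) = D at *
    generalize (n : ℂ) ^ ((s + lam + 1) / 2) = xa at *
    generalize (n : ℂ) ^ ((s - lam + 1) / 2) = xb at *
    generalize (n : ℂ) ^ (s / 2) = xc at *
    generalize (n : ℂ) ^ (s / 2 + 1 / 2) = xd at *
    generalize (n : ℂ) ^ (1 / 2 : ℂ) = r at *
    generalize cosPowerIntegral lam (s + 2 + 2 * n) = J at *
    rw [show cosPowerIntegral lam s = A * B * J / (C * D) by
      rw [← h]; field_simp]
    field_simp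
    linear_combination J * hpow

lemma image_cos_Ioo_zero_pi_div_two : Real.cos '' Ioo 0 (π / 2) = Ioo 0 1 := by
  ext y
  constructor
  · rintro ⟨x, hx, rfl⟩
    refine ⟨cos_pos_of_mem_Ioo_zero_pi_div_two hx, ?_⟩
    rw [← Real.cos_zero]
    exact Real.cos_lt_cos_of_nonneg_of_le_pi le_rfl (by linarith [hx.2, Real.pi_pos]) hx.1
  · rintro ⟨h0, h1⟩
    exact ⟨Real.arccos y, ⟨Real.arccos_pos.2 h1, Real.arccos_lt_pi_div_two.2 h0⟩,
      Real.cos_arccos (by linarith) h1.le⟩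

lemma setIntegral_Ioo_cos_arccos_eq_cosPowerIntegral (lam : ℝ) (s : ℂ) :
    (∫ y in Ioo (0 : ℝ) 1, ((Real.cos (lam * Real.arccos y) / √(1 - y ^ 2) : ℝ) : ℂ) *
      (y : ℂ) ^ (s - 1)) = cosPowerIntegral lam s := by
  have hpi {x : ℝ} (hx : x ∈ Ioo 0 (π / 2)) : x ∈ Icc 0 π :=
    ⟨hx.1.le, by linarith [hx.2, Real.pi_pos]⟩
  rw [← image_cos_Ioo_zero_pi_div_two, integral_image_eq_integral_abs_deriv_smul measurableSet_Ioo
    (fun x _ => (Real.hasDerivAt_cos x).hasDerivWithinAt)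
    (Real.injOn_cos.mono fun x hx => hpi hx), cosPowerIntegral]
  refine setIntegral_congr_fun measurableSet_Ioo fun x hx => ?_
  have hsin : 0 < Real.sin x := Real.sin_pos_of_pos_of_lt_pi hx.1 (by linarith [hx.2, Real.pi_pos])
  have hsin' : (Real.sin x : ℂ) ≠ 0 := by exact_mod_cast hsin.ne'
  simp only [Real.arccos_cos (hpi hx).1 (hpi hx).2, ← Real.sin_sq, Real.sqrt_sq hsin.le, abs_neg,
    abs_of_pos hsin, Complex.real_smul, Complex.ofReal_div]
  field_simp

lemma GammaC_div_eq_Gamma (lam s : ℂ) :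
    GammaC s / ((2 : ℂ) ^ s * GammaC ((s + lam + 1) / 2) * GammaC ((s - lam + 1) / 2)) =
      π * Complex.Gamma s / (2 ^ s * Complex.Gamma ((s + lam + 1) / 2) *
        Complex.Gamma ((s - lam + 1) / 2)) := by
  have h2pi : ((2 * π : ℝ) : ℂ) ≠ 0 := by exact_mod_cast (by positivity : (2 * π : ℝ) ≠ 0)
  have hpow : ((2 * π : ℝ) : ℂ) ^ (-s) = ((2 * π : ℝ) : ℂ) ^ (-((s + lam + 1) / 2)) *
      ((2 * π : ℝ) : ℂ) ^ (-((s - lam + 1) / 2)) * ((2 * π : ℝ) : ℂ) := by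
    rw [← Complex.cpow_add _ _ h2pi,
      show -s = -((s + lam + 1) / 2) + -((s - lam + 1) / 2) + 1 by ring,
      Complex.cpow_add _ _ h2pi, Complex.cpow_one]
  have h1 : ((2 * π : ℝ) : ℂ) ^ (-((s + lam + 1) / 2)) ≠ 0 := by
    simp only [ne_eq, Complex.cpow_eq_zero_iff, h2pi, false_and, not_false_eq_true]
  have h2 : ((2 * π : ℝ) : ℂ) ^ (-((s - lam + 1) / 2)) ≠ 0 := by
    simp only [ne_eq, Complex.cpow_eq_zero_iff, h2pi, false_and, not_false_eq_true]
  simp only [GammaC, hpow]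
  generalize ((2 * π : ℝ) : ℂ) ^ (-((s + lam + 1) / 2)) = x at *
  generalize ((2 * π : ℝ) : ℂ) ^ (-((s - lam + 1) / 2)) = y at *
  push_cast
  rw [show (2 : ℂ) * (x * y * (2 * π)) * Complex.Gamma s =
      (4 * x * y) * (π * Complex.Gamma s) by ring,
    show (2 : ℂ) ^ s * (2 * x * Complex.Gamma ((s + lam + 1) / 2)) *
      (2 * y * Complex.Gamma ((s - lam + 1) / 2)) = (4 * x * y) *
      (2 ^ s * Complex.Gamma ((s + lam + 1) / 2) * Complex.Gamma ((s - lam + 1) / 2)) by ring,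
    mul_div_mul_left _ _ (by simp [h1, h2])]

/-- For real `λ > 1`, the function `f_λ(y) = cos(λ arccos y)/√(1-y²)` on `(0,1)`
(and `0` elsewhere) has Mellin transform
`Γ_ℂ(s) / (2^s Γ_ℂ((s+λ+1)/2) Γ_ℂ((s-λ+1)/2))` for `Re(s) > 0`. -/
theorem mellin_of_cos_arccos (lam : ℝ) (hlam : 1 < lam) (s : ℂ) (hs : 0 < s.re) :
    (∫ y : ℝ in Set.Ioi (0 : ℝ),
        ((if y < 1 then Real.cos (lam * Real.arccos y) / Real.sqrt (1 - y ^ 2) else 0 : ℝ) : ℂ)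
          * (y : ℂ) ^ (s - 1))
      = GammaC s /
          ((2 : ℂ) ^ s * GammaC ((s + lam + 1) / 2) * GammaC ((s - lam + 1) / 2)) := by
  rw [GammaC_div_eq_Gamma, ← cosPowerIntegral_eq_Gamma lam hs,
    ← setIntegral_Ioo_cos_arccos_eq_cosPowerIntegral, ← Ioi_inter_Iio,
    ← setIntegral_indicator measurableSet_Iio]
  refine setIntegral_congr_fun measurableSet_Ioi fun y _ => ?_
  by_cases hy : y < 1 <;> simp [hy]
end

section
/- Let λ ≥ 9/2, let γ(s) = Q^s ∏_{j=1}^r Γ(λ_j s + μ_j) with λ_j > 0, Σλ_j = 1, Re(μ_j) > -λ_j/2, and fix s with Re(s) ∈ (1/2, (λ-1)/2) and σ₁ ∈ ((1-λ)/2, -Re(s)). Then for x > 0, F_λ(s,x) := (1/2πi)∫_{Re(u)=σ₁} [Γ_ℂ(u+(λ-1)/2)·γ(1-s-u)] / [Γ_ℂ(-u+(λ+1)/2)·γ(s+u)] · x^u du converges absolutely and satisfies |F_λ(s,x)| ≪ x^{σ₁}, with implied constant independent of x. -/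
open scoped Real BigOperators

open Asymptotics Filter

theorem abs_two_mul_div_sq_add_sq_sub_le (x y : ℝ) {t : ℝ} (ht : t ≠ 0) :
    |2 * x / (x ^ 2 + t ^ 2) - 2 * y / (y ^ 2 + t ^ 2)| ≤
      |x - y| * (1 / (x ^ 2 + t ^ 2) + 1 / (y ^ 2 + t ^ 2)) := by
  have hx : 0 < x ^ 2 + t ^ 2 := by positivity
  have hy : 0 < y ^ 2 + t ^ 2 := by positivity
  have h₁ : 2 * x / (x ^ 2 + t ^ 2) - 2 * y / (y ^ 2 + t ^ 2) =
      (x - y) * (2 * (t ^ 2 - x * y) / ((x ^ 2 + t ^ 2) * (y ^ 2 + t ^ 2))) := by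
    field_simp
    ring
  have h₂ : 1 / (x ^ 2 + t ^ 2) + 1 / (y ^ 2 + t ^ 2) =
      (x ^ 2 + y ^ 2 + 2 * t ^ 2) / ((x ^ 2 + t ^ 2) * (y ^ 2 + t ^ 2)) := by
    field_simp
    ring
  rw [h₁, h₂, abs_mul, abs_div, abs_of_pos (mul_pos hx hy)]
  gcongr
  rw [abs_le]
  constructor <;> nlinarith [sq_nonneg (x - y), sq_nonneg (x + y), sq_nonneg t]

theorem one_div_sq_add_sq_le {x k t M : ℝ} (ht : 1 ≤ |t|) (hxk : |x - k| ≤ M) :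
    1 / (x ^ 2 + t ^ 2) ≤ (2 * M ^ 2 + 2) / (k ^ 2 + 1) := by
  have ht' : 1 ≤ t ^ 2 := by rw [← sq_abs]; nlinarith
  have h : (x - k) ^ 2 ≤ M ^ 2 := sq_le_sq' (neg_le_of_abs_le hxk) (le_of_abs_le hxk)
  rw [div_le_div_iff₀ (by positivity) (by positivity)]
  nlinarith [sq_nonneg (2 * x - k), sq_nonneg x, sq_nonneg M,
    mul_nonneg (sq_nonneg M) (sq_nonneg x)]

theorem abs_log_sq_add_sq_second_difference_le {a b k t M : ℝ} (ht : 1 ≤ |t|) (hM : 1 ≤ M)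
    (ha : |a| ≤ M) (hb : |b| ≤ M) :
    |Real.log ((k + a) ^ 2 + t ^ 2) - Real.log ((k + b) ^ 2 + t ^ 2) -
        (a - b) * (Real.log ((k + 1) ^ 2 + t ^ 2) - Real.log (k ^ 2 + t ^ 2))| ≤
      16 * M ^ 2 * (M ^ 2 + 1) * (1 / (k ^ 2 + 1)) := by
  have ht0 : t ≠ 0 := by
    rintro rfl
    norm_num at ht
  have hd : ∀ y : ℝ, HasDerivAt (fun y => Real.log ((k + y) ^ 2 + t ^ 2))
      (2 * (k + y) / ((k + y) ^ 2 + t ^ 2)) y := by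
    intro y
    have h : HasDerivAt (fun y => (k + y) ^ 2 + t ^ 2) (2 * (k + y)) y := by
      simpa using (((hasDerivAt_id' y).const_add k).fun_pow 2).add_const (t ^ 2)
    exact h.log (by positivity)
  obtain ⟨ξ, hξ, hξ'⟩ := exists_hasDerivAt_eq_slope _ _ zero_lt_one
    (fun y _ => (hd y).continuousAt.continuousWithinAt) (fun y _ => hd y)
  simp only [add_zero, sub_zero, div_one] at hξ'
  rw [← hξ']
  set d := 2 * (k + ξ) / ((k + ξ) ^ 2 + t ^ 2)
  have key : ∀ y ∈ Set.Icc (-M) M, ‖2 * (k + y) / ((k + y) ^ 2 + t ^ 2) - d‖ ≤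
      2 * M * (2 * ((2 * M ^ 2 + 2) / (k ^ 2 + 1))) := by
    intro y hy
    rw [Real.norm_eq_abs]
    refine (abs_two_mul_div_sq_add_sq_sub_le _ _ ht0).trans ?_
    have h₁ := one_div_sq_add_sq_le (x := k + y) (k := k) (M := M) ht
      (by rw [add_sub_cancel_left]; exact abs_le.2 hy)
    have h₂ := one_div_sq_add_sq_le (x := k + ξ) (k := k) (M := M) ht
      (by rw [add_sub_cancel_left]; exact abs_le.2 ⟨by linarith [hξ.1], by linarith [hξ.2]⟩)
    have h₃ : |k + y - (k + ξ)| ≤ 2 * M :=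
      abs_le.2 ⟨by linarith [hξ.2, hy.1], by linarith [hξ.1, hy.2]⟩
    exact mul_le_mul h₃ ((add_le_add h₁ h₂).trans_eq (two_mul _).symm) (by positivity) (by positivity)
  have h := (convex_Icc (-M) M).norm_image_sub_le_of_norm_hasDerivWithin_le
    (f := fun y => Real.log ((k + y) ^ 2 + t ^ 2) - y * d)
    (fun y _ => ((hd y).sub (by simpa using (hasDerivAt_id y).mul_const d)).hasDerivWithinAt)
    key (abs_le.1 hb) (abs_le.1 ha)
  simp only [Real.norm_eq_abs] at h
  have hab : |a - b| ≤ 2 * M := (abs_sub a b).trans (by linarith)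
  calc _ = |Real.log ((k + a) ^ 2 + t ^ 2) - a * d - (Real.log ((k + b) ^ 2 + t ^ 2) - b * d)| := by
        congr 1
        ring
    _ ≤ _ := h
    _ ≤ 2 * M * (2 * ((2 * M ^ 2 + 2) / (k ^ 2 + 1))) * (2 * M) := by gcongr
    _ = _ := by ring

theorem Complex.norm_ofReal_add_ofReal_mul_I (a t : ℝ) :
    ‖(a : ℂ) + t * Complex.I‖ = √(a ^ 2 + t ^ 2) := by
  rw [Complex.norm_def, Complex.normSq_add_mul_I]

theorem log_norm_GammaSeq {n : ℕ} (hn : n ≠ 0) (a : ℝ) {t : ℝ} (ht : t ≠ 0) :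
    Real.log ‖Complex.GammaSeq (a + t * Complex.I) n‖ =
      a * Real.log n + Real.log n.factorial -
        (∑ k ∈ Finset.range (n + 1), Real.log ((k + a) ^ 2 + t ^ 2)) / 2 := by
  have hn' : (0 : ℝ) < n := by positivity
  have hnorm : ∀ k : ℕ, ‖(a : ℂ) + t * Complex.I + k‖ = √((k + a) ^ 2 + t ^ 2) := by
    intro k
    rw [← Complex.norm_ofReal_add_ofReal_mul_I]
    congr 1
    push_cast
    ring
  have hpos : ∀ k : ℕ, 0 < √((k + a) ^ 2 + t ^ 2) := fun k => by positivity
  rw [Complex.GammaSeq, norm_div, norm_mul, norm_prod, ← Complex.ofReal_natCast,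
    Complex.norm_cpow_eq_rpow_re_of_pos hn', Complex.norm_natCast]
  simp only [hnorm]
  rw [Real.log_div (by positivity) (Finset.prod_ne_zero_iff.2 fun k _ => (hpos k).ne'),
    Real.log_mul (by positivity) (by positivity), Real.log_rpow hn',
    Real.log_prod (fun k _ => (hpos k).ne'), Finset.sum_div]
  simp only [Real.log_sqrt (add_nonneg (sq_nonneg _) (sq_nonneg _))]
  simp

theorem summable_one_div_sq_add_one : Summable fun k : ℕ => 1 / ((k : ℝ) ^ 2 + 1) :=
  (Real.summable_one_div_nat_pow.2 one_lt_two |> (summable_nat_add_iff 1).2).mul_left 2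
    |>.of_nonneg_of_le (fun k => by positivity) fun k => by
      push_cast
      rw [mul_one_div, div_le_div_iff₀ (by positivity) (by positivity)]
      nlinarith [sq_nonneg ((k : ℝ) - 1)]

theorem Gamma_ne_zero_of_im_ne_zero (a : ℝ) {t : ℝ} (ht : t ≠ 0) :
    Complex.Gamma (a + t * Complex.I) ≠ 0 := by
  refine Complex.Gamma_ne_zero fun m h => ht ?_
  simpa using congrArg Complex.im h

theorem tendsto_log_sub_half_log_sq_add_sq (t : ℝ) :
    Tendsto (fun n : ℕ => Real.log n - Real.log (((n : ℝ) + 1) ^ 2 + t ^ 2) / 2) atTop (nhds 0) := by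
  have h0 : Tendsto (fun n : ℕ => (1 : ℝ) / n) atTop (nhds 0) := tendsto_one_div_atTop_nhds_zero_nat
  have h1 : Tendsto (fun n : ℕ => -(Real.log ((1 + (1 : ℝ) / n) ^ 2 + (t * (1 / n)) ^ 2) / 2)) atTop
      (nhds (-(Real.log ((1 + 0) ^ 2 + (t * 0) ^ 2) / 2))) := by
    refine (Tendsto.log ?_ (by norm_num)).div_const 2 |>.neg
    exact ((h0.const_add 1).pow 2).add ((h0.const_mul t).pow 2)
  have h2 : -(Real.log ((1 + 0) ^ 2 + (t * 0) ^ 2) / 2) = 0 := by norm_num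
  rw [h2] at h1
  refine h1.congr' ?_
  filter_upwards [eventually_gt_atTop 0] with n hn
  have hn' : (0 : ℝ) < n := by exact_mod_cast hn
  have : (1 + (1 : ℝ) / n) ^ 2 + (t * (1 / n)) ^ 2 = (((n : ℝ) + 1) ^ 2 + t ^ 2) / n ^ 2 := by
    field_simp
  rw [this, Real.log_div (by positivity) (by positivity), Real.log_pow]
  push_cast
  ring

theorem exists_abs_log_norm_Gamma_sub_le (a b : ℝ) : ∃ K : ℝ, ∀ t : ℝ, 1 ≤ |t| →
    |Real.log ‖Complex.Gamma (a + t * Complex.I)‖ - Real.log ‖Complex.Gamma (b + t * Complex.I)‖ -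
      (a - b) * (Real.log |t|)| ≤ K := by
  set M := max 1 (max |a| |b|)
  have hM : 1 ≤ M := le_max_left _ _
  have ha : |a| ≤ M := (le_max_left _ _).trans (le_max_right _ _)
  have hb : |b| ≤ M := (le_max_right _ _).trans (le_max_right _ _)
  refine ⟨16 * M ^ 2 * (M ^ 2 + 1) * (∑' k : ℕ, 1 / ((k : ℝ) ^ 2 + 1)) / 2, fun t ht => ?_⟩
  have ht0 : t ≠ 0 := by
    rintro rfl
    norm_num at ht
  have hlim : ∀ c : ℝ, Tendsto (fun n => Real.log ‖Complex.GammaSeq (c + t * Complex.I) n‖) atTop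
      (nhds (Real.log ‖Complex.Gamma (c + t * Complex.I)‖)) := fun c =>
    (Complex.GammaSeq_tendsto_Gamma _).norm.log (norm_ne_zero_iff.2 (Gamma_ne_zero_of_im_ne_zero c ht0))
  have hlim' := (((hlim a).sub (hlim b)).sub
    (((tendsto_log_sub_half_log_sq_add_sq t).add_const (Real.log |t|)).const_mul (a - b))).abs
  rw [zero_add] at hlim'
  refine le_of_tendsto hlim' ?_
  filter_upwards [eventually_ne_atTop 0] with n hn
  have htel := Finset.sum_range_sub (fun k : ℕ => Real.log ((k : ℝ) ^ 2 + t ^ 2)) (n + 1)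
  have hlog0 : Real.log (((0 : ℕ) : ℝ) ^ 2 + t ^ 2) = 2 * Real.log |t| := by
    rw [Real.log_abs]
    simp
  rw [hlog0] at htel
  push_cast at htel
  have hsum : ∀ n : ℕ, ∑ k ∈ Finset.range n, 1 / ((k : ℝ) ^ 2 + 1) ≤
      ∑' k : ℕ, 1 / ((k : ℝ) ^ 2 + 1) := fun n =>
    summable_one_div_sq_add_one.sum_le_tsum _ fun k _ => by positivity
  rw [log_norm_GammaSeq hn a ht0, log_norm_GammaSeq hn b ht0]
  calc _ = |∑ k ∈ Finset.range (n + 1), (Real.log ((k + a) ^ 2 + t ^ 2) -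
            Real.log ((k + b) ^ 2 + t ^ 2) - (a - b) *
              (Real.log (((k : ℝ) + 1) ^ 2 + t ^ 2) - Real.log ((k : ℝ) ^ 2 + t ^ 2)))| / 2 := by
        rw [Finset.sum_sub_distrib, Finset.sum_sub_distrib, ← Finset.mul_sum, htel,
          ← abs_neg, ← abs_two, ← abs_div, abs_two]
        congr 1
        ring
    _ ≤ (∑ k ∈ Finset.range (n + 1), 16 * M ^ 2 * (M ^ 2 + 1) * (1 / ((k : ℝ) ^ 2 + 1))) / 2 := by
        gcongr
        refine (Finset.abs_sum_le_sum_abs _ _).trans (Finset.sum_le_sum fun k _ => ?_)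
        exact abs_log_sq_add_sq_second_difference_le ht hM ha hb
    _ ≤ _ := by
        rw [← Finset.mul_sum]
        gcongr
        exact hsum _

theorem norm_Gamma_one_half_add_sq (t : ℝ) :
    ‖Complex.Gamma ((1 / 2 : ℝ) + t * Complex.I)‖ ^ 2 = π / Real.cosh (π * t) := by
  have h := Complex.Gamma_mul_Gamma_one_sub ((1 / 2 : ℝ) + t * Complex.I)
  have h1 : (1 : ℂ) - ((1 / 2 : ℝ) + t * Complex.I) =
      (starRingEnd ℂ) ((1 / 2 : ℝ) + t * Complex.I) := by
    simp only [map_add, map_mul, Complex.conj_ofReal, Complex.conj_I]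
    push_cast
    ring
  have h2 : Complex.sin (π * ((1 / 2 : ℝ) + t * Complex.I)) = Real.cosh (π * t) := by
    rw [show (π : ℂ) * ((1 / 2 : ℝ) + t * Complex.I) =
      (π * t : ℝ) * Complex.I + π / 2 by push_cast; ring, Complex.sin_add_pi_div_two,
      Complex.cos_mul_I, Complex.ofReal_cosh]
  rw [h1, h2, Complex.Gamma_conj, Complex.mul_conj, Complex.normSq_eq_norm_sq] at h
  exact_mod_cast h

theorem abs_log_norm_Gamma_one_half_add_le (t : ℝ) :
    |Real.log ‖Complex.Gamma ((1 / 2 : ℝ) + t * Complex.I)‖ - (-(π / 2 * |t|))| ≤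
      |Real.log π| + Real.log 2 := by
  have h := congrArg Real.log (norm_Gamma_one_half_add_sq t)
  rw [Real.log_pow, Real.log_div Real.pi_ne_zero (Real.cosh_pos _).ne', Nat.cast_ofNat] at h
  have habs : |π * t| = π * |t| := by rw [abs_mul, abs_of_pos Real.pi_pos]
  have hle : Real.log (Real.cosh (π * t)) ≤ π * |t| := by
    rw [← habs, ← Real.cosh_abs, Real.log_le_iff_le_exp (Real.cosh_pos _), Real.cosh_eq]
    have := Real.exp_le_exp.2 (show -|π * t| ≤ |π * t| by linarith [abs_nonneg (π * t)])
    linarith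
  have hge : π * |t| - Real.log 2 ≤ Real.log (Real.cosh (π * t)) := by
    rw [← habs, ← Real.cosh_abs, Real.le_log_iff_exp_le (Real.cosh_pos _), Real.exp_sub,
      Real.exp_log two_pos, Real.cosh_eq]
    have := Real.exp_pos (-|π * t|)
    linarith
  have h2 := Real.log_pos one_lt_two
  have h3 := neg_abs_le (Real.log π)
  have h4 := le_abs_self (Real.log π)
  rw [abs_le]
  constructor <;> linarith [abs_nonneg (Real.log π)]

theorem exists_abs_log_norm_Gamma_le (a : ℝ) : ∃ K : ℝ, ∀ t : ℝ, 1 ≤ |t| →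
    |Real.log ‖Complex.Gamma (a + t * Complex.I)‖ -
      ((a - 1 / 2) * Real.log |t| - π / 2 * |t|)| ≤ K := by
  obtain ⟨K, hK⟩ := exists_abs_log_norm_Gamma_sub_le a (1 / 2)
  refine ⟨K + (|Real.log π| + Real.log 2), fun t ht => ?_⟩
  refine le_trans (le_of_eq_of_le ?_ (abs_add_le _ _))
    (add_le_add (hK t ht) (abs_log_norm_Gamma_one_half_add_le t))
  congr 1
  ring

theorem isTheta_of_abs_log_norm_sub_log_norm_le {α E F : Type*} [NormedAddCommGroup E]
    [NormedAddCommGroup F] {l : Filter α} {f : α → E} {g : α → F} {K : ℝ}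
    (hf : ∀ᶠ x in l, f x ≠ 0) (hg : ∀ᶠ x in l, g x ≠ 0)
    (h : ∀ᶠ x in l, |Real.log ‖f x‖ - Real.log ‖g x‖| ≤ K) : f =Θ[l] g := by
  constructor
  all_goals
    refine IsBigO.of_bound (Real.exp K) ?_
    filter_upwards [hf, hg, h] with x hfx hgx hx
    have hf' := norm_pos_iff.2 hfx
    have hg' := norm_pos_iff.2 hgx
    rw [abs_le] at hx
    rw [← Real.log_le_log_iff (by positivity) (by positivity),
      Real.log_mul (by positivity) (by positivity), Real.log_exp]
    linarith

/-- Stirling's formula on a vertical line, up to constants. -/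
theorem Gamma_isTheta_cocompact (w : ℂ) {c : ℝ} (hc : c ≠ 0) :
    (fun t : ℝ => Complex.Gamma (w + (c * t : ℝ) * Complex.I)) =Θ[cocompact ℝ]
      fun t => (1 + |t|) ^ (w.re - 1 / 2) * Real.exp (-(π / 2 * (|c| * |t|))) := by
  obtain ⟨K, hK⟩ := exists_abs_log_norm_Gamma_le w.re
  have hc' : 0 < |c| := abs_pos.2 hc
  have hw : ∀ t : ℝ, w + (c * t : ℝ) * Complex.I = w.re + (w.im + c * t : ℝ) * Complex.I := by
    intro t
    conv_lhs => rw [← Complex.re_add_im w]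
    push_cast
    ring
  have htend : Tendsto (fun t : ℝ => |c| * |t|) (cocompact ℝ) atTop :=
    tendsto_norm_cocompact_atTop.const_mul_atTop hc'
  have hlarge : ∀ᶠ t : ℝ in cocompact ℝ, 2 * (|w.im| + 1) + |c| ≤ |c| * |t| :=
    htend.eventually_ge_atTop _
  have htri : ∀ t : ℝ, |(|w.im + c * t| - |c| * |t|)| ≤ |w.im| := by
    intro t
    rw [← abs_mul]
    refine (abs_abs_sub_abs_le_abs_sub _ _).trans ?_
    simp
  have hlog : ∀ᶠ t : ℝ in cocompact ℝ, |Real.log |w.im + c * t| - Real.log (1 + |t|)| ≤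
      |(Real.log |c|)| + Real.log 4 := by
    filter_upwards [hlarge] with t ht
    have h := abs_le.1 (htri t)
    have h0 := abs_nonneg w.im
    have ht1 : 1 ≤ |t| := by nlinarith [abs_nonneg t]
    have hlow : |c| / 4 * (1 + |t|) ≤ |w.im + c * t| := by nlinarith
    have hup : |w.im + c * t| ≤ |c| * 4 * (1 + |t|) := by nlinarith
    have h1 := Real.log_le_log (by positivity) hlow
    have h2 := Real.log_le_log (by linarith) hup
    rw [Real.log_mul (by positivity) (by positivity), Real.log_div (by positivity) (by norm_num)] at h1
    rw [Real.log_mul (by positivity) (by positivity), Real.log_mul (by positivity) (by norm_num)] at h2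
    rw [abs_le]
    constructor <;> linarith [neg_abs_le (Real.log |c|), le_abs_self (Real.log |c|)]
  have hone : ∀ᶠ t : ℝ in cocompact ℝ, 1 ≤ |w.im + c * t| := by
    filter_upwards [hlarge] with t ht
    linarith [abs_le.1 (htri t), abs_nonneg w.im]
  refine isTheta_of_abs_log_norm_sub_log_norm_le
    (K := K + (|w.re - 1 / 2| * (|(Real.log |c|)| + Real.log 4) + π / 2 * |w.im|)) ?_ ?_ ?_
  · filter_upwards [hone] with t ht
    rw [hw]
    refine Gamma_ne_zero_of_im_ne_zero _ fun h => ?_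
    rw [h] at ht
    norm_num at ht
  · exact Eventually.of_forall fun t => by positivity
  · filter_upwards [hone, hlog] with t ht hlt
    rw [hw, Real.norm_of_nonneg (by positivity), Real.log_mul (by positivity) (by positivity),
      Real.log_exp, Real.log_rpow (by positivity)]
    have h1 := hK _ ht
    have h2 : |(w.re - 1 / 2) * (Real.log |w.im + c * t| - Real.log (1 + |t|))| ≤
        |w.re - 1 / 2| * (|(Real.log |c|)| + Real.log 4) := by
      rw [abs_mul]
      gcongr
    have h3 : |π / 2 * (|c| * |t| - |w.im + c * t|)| ≤ π / 2 * |w.im| := by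
      rw [abs_mul, abs_of_pos (by positivity : 0 < π / 2), abs_sub_comm]
      exact mul_le_mul_of_nonneg_left (htri t) (by positivity)
    refine le_trans (le_of_eq_of_le ?_ (abs_add_le _ _)) (add_le_add h1
      ((abs_add_le _ _).trans (add_le_add h2 h3)))
    congr 1
    ring

theorem ofReal_cpow_isTheta_one {A : ℝ} (hA : 0 < A) (w : ℂ) (c : ℝ) (l : Filter ℝ) :
    (fun t : ℝ => (A : ℂ) ^ (w + (c * t : ℝ) * Complex.I)) =Θ[l] fun _ => (1 : ℝ) := by
  have h : (fun t : ℝ => ‖(A : ℂ) ^ (w + (c * t : ℝ) * Complex.I)‖) = fun _ => A ^ w.re := by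
    funext t
    rw [Complex.norm_cpow_eq_rpow_re_of_pos hA, Complex.add_re, Complex.re_ofReal_mul]
    simp
  rw [← isTheta_norm_left, h]
  exact isTheta_const_const (by positivity) one_ne_zero

theorem GammaC_isTheta_cocompact (w : ℂ) {c : ℝ} (hc : c ≠ 0) :
    (fun t : ℝ => GammaC (w + (c * t : ℝ) * Complex.I)) =Θ[cocompact ℝ]
      fun t => (1 + |t|) ^ (w.re - 1 / 2) * Real.exp (-(π / 2 * (|c| * |t|))) := by
  have h₁ := ofReal_cpow_isTheta_one Real.two_pi_pos (-w) (-c) (cocompact ℝ)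
  have h₂ : (fun _ : ℝ => (2 : ℂ)) =Θ[cocompact ℝ] fun _ => (1 : ℝ) :=
    isTheta_const_const two_ne_zero one_ne_zero
  refine ((EventuallyEq.of_eq (funext fun t => ?_)).trans_isTheta
    ((h₂.mul h₁).mul (Gamma_isTheta_cocompact w hc))).trans_eventuallyEq
    (EventuallyEq.of_eq (funext fun t => ?_))
  · rw [GammaC]
    congr 3
    push_cast
    ring
  · ring

theorem gammaFactor_isTheta_cocompact {r : ℕ} {Q : ℝ} (hQ : 0 < Q) {lamj : Fin r → ℝ}
    (hlamj : ∀ j, 0 < lamj j) (mu : Fin r → ℂ) (hsum : ∑ j, lamj j = 1) {γ : ℂ → ℂ}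
    (hγ : ∀ w : ℂ, γ w = ((Q : ℂ) ^ w) * ∏ j, Complex.Gamma ((lamj j : ℂ) * w + mu j))
    (w : ℂ) {c : ℝ} (hc : c ≠ 0) :
    (fun t : ℝ => γ (w + (c * t : ℝ) * Complex.I)) =Θ[cocompact ℝ]
      fun t => (1 + |t|) ^ (w.re + ∑ j, ((mu j).re - 1 / 2)) *
        Real.exp (-(π / 2 * (|c| * |t|))) := by
  have hprod : (fun t : ℝ => ∏ j, Complex.Gamma (lamj j * w + mu j + (lamj j * c * t : ℝ) * Complex.I))
      =Θ[cocompact ℝ] fun t => ∏ j, ((1 + |t|) ^ ((lamj j * w + mu j).re - 1 / 2) *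
        Real.exp (-(π / 2 * (|lamj j * c| * |t|)))) := by
    constructor
    · exact IsBigO.finsetProd fun j _ =>
        (Gamma_isTheta_cocompact (lamj j * w + mu j) (mul_ne_zero (hlamj j).ne' hc)).1
    · exact IsBigO.finsetProd fun j _ =>
        (Gamma_isTheta_cocompact (lamj j * w + mu j) (mul_ne_zero (hlamj j).ne' hc)).2
  refine ((EventuallyEq.of_eq (funext fun t => ?_)).trans_isTheta
    ((ofReal_cpow_isTheta_one hQ w c (cocompact ℝ)).mul hprod)).trans_eventuallyEq
    (EventuallyEq.of_eq (funext fun t => ?_))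
  · rw [hγ]
    congr 1
    refine Finset.prod_congr rfl fun j _ => ?_
    congr 1
    push_cast
    ring
  · rw [one_mul, Finset.prod_mul_distrib, ← Real.exp_sum, ← Real.rpow_sum_of_pos (by positivity)]
    congr 2
    · rw [← one_mul w.re, ← hsum, Finset.sum_mul, ← Finset.sum_add_distrib]
      refine Finset.sum_congr rfl fun j _ => ?_
      rw [Complex.add_re, Complex.re_ofReal_mul]
      ring
    · rw [← one_mul (-(π / 2 * (|c| * |t|))), ← hsum, Finset.sum_mul]
      refine Finset.sum_congr rfl fun j _ => ?_
      rw [abs_mul, abs_of_pos (hlamj j)]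
      ring

theorem continuous_ofReal_cpow {A : ℝ} (hA : 0 < A) : Continuous fun w : ℂ => (A : ℂ) ^ w :=
  continuous_id.const_cpow (Or.inl (Complex.ofReal_ne_zero.2 hA.ne'))

theorem continuous_Gamma_inv : Continuous fun w : ℂ => (Complex.Gamma w)⁻¹ :=
  Complex.differentiable_one_div_Gamma.continuous

theorem continuousAt_Gamma_of_re_pos {w : ℂ} (hw : 0 < w.re) : ContinuousAt Complex.Gamma w := by
  refine (Complex.differentiableAt_Gamma w fun m h => ?_).continuousAt
  rw [h] at hw
  simp only [Complex.neg_re, Complex.natCast_re] at hw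
  linarith [(Nat.cast_nonneg m : (0 : ℝ) ≤ m)]

theorem continuousAt_GammaC_of_re_pos {w : ℂ} (hw : 0 < w.re) : ContinuousAt GammaC w :=
  (continuousAt_const.mul
    ((continuous_ofReal_cpow Real.two_pi_pos).comp continuous_neg).continuousAt).mul
    (continuousAt_Gamma_of_re_pos hw)

theorem continuous_GammaC_inv : Continuous fun w => (GammaC w)⁻¹ := by
  have h₁ : Continuous fun w : ℂ => (((2 * π : ℝ) : ℂ) ^ (-w))⁻¹ :=
    ((continuous_ofReal_cpow Real.two_pi_pos).comp continuous_neg).inv₀ fun w =>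
      Complex.cpow_ne_zero_iff.2 (Or.inl (Complex.ofReal_ne_zero.2 Real.two_pi_pos.ne'))
  simp only [GammaC, mul_inv]
  exact (continuous_const.mul h₁).mul continuous_Gamma_inv

theorem continuousAt_gammaFactor {r : ℕ} {Q : ℝ} (hQ : 0 < Q) {lamj : Fin r → ℝ}
    {mu : Fin r → ℂ} {γ : ℂ → ℂ}
    (hγ : ∀ w : ℂ, γ w = ((Q : ℂ) ^ w) * ∏ j, Complex.Gamma ((lamj j : ℂ) * w + mu j))
    {w : ℂ} (hw : ∀ j, 0 < ((lamj j : ℂ) * w + mu j).re) : ContinuousAt γ w := by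
  rw [funext hγ]
  refine (continuous_ofReal_cpow hQ).continuousAt.mul (tendsto_finsetProd _ fun j _ => ?_)
  exact (continuousAt_Gamma_of_re_pos (hw j)).comp
    (f := fun w => (lamj j : ℂ) * w + mu j) (by fun_prop)

theorem continuous_gammaFactor_inv {r : ℕ} {Q : ℝ} (hQ : 0 < Q) {lamj : Fin r → ℝ}
    {mu : Fin r → ℂ} {γ : ℂ → ℂ}
    (hγ : ∀ w : ℂ, γ w = ((Q : ℂ) ^ w) * ∏ j, Complex.Gamma ((lamj j : ℂ) * w + mu j)) :
    Continuous fun w => (γ w)⁻¹ := by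
  simp only [hγ, mul_inv, ← Finset.prod_inv_distrib]
  refine ((continuous_ofReal_cpow hQ).inv₀ fun w => ?_).mul (continuous_finsetProd _ fun j _ => ?_)
  · exact Complex.cpow_ne_zero_iff.2 (Or.inl (Complex.ofReal_ne_zero.2 hQ.ne'))
  · exact continuous_Gamma_inv.comp (by fun_prop)

theorem integrable_of_continuous_of_isBigO_rpow {f : ℝ → ℂ} (hf : Continuous f) {p : ℝ}
    (hp : 1 < p) (h : f =O[cocompact ℝ] fun t => (1 + |t|) ^ (-p)) :
    MeasureTheory.Integrable f := by
  refine hf.locallyIntegrable.integrable_of_isBigO_cocompact h ?_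
  exact (integrable_one_add_norm (E := ℝ) (by simpa using hp)).integrableAtFilter _

theorem integrable_mul_ofReal_cpow_and_norm_integral_le {f : ℝ → ℂ}
    (hf : MeasureTheory.Integrable f) {x : ℝ} (hx : 0 < x) (σ : ℝ) :
    MeasureTheory.Integrable (fun t : ℝ => f t * (x : ℂ) ^ ((σ : ℂ) + t * Complex.I)) ∧
      ‖∫ t : ℝ, f t * (x : ℂ) ^ ((σ : ℂ) + t * Complex.I) * Complex.I‖ ≤
        (∫ t : ℝ, ‖f t‖) * x ^ σ := by
  have hnorm : ∀ t : ℝ, ‖(x : ℂ) ^ ((σ : ℂ) + t * Complex.I)‖ = x ^ σ := by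
    intro t
    rw [Complex.norm_cpow_eq_rpow_re_of_pos hx]
    simp
  have hcont : Continuous fun t : ℝ => (x : ℂ) ^ ((σ : ℂ) + t * Complex.I) :=
    (continuous_ofReal_cpow hx).comp (by fun_prop)
  refine ⟨hf.mul_bdd (c := x ^ σ) hcont.aestronglyMeasurable
    (Eventually.of_forall fun t => (hnorm t).le), ?_⟩
  refine (MeasureTheory.norm_integral_le_integral_norm _).trans_eq ?_
  simp only [norm_mul, hnorm, Complex.norm_I, mul_one]
  exact MeasureTheory.integral_mul_const _ _

/-- For `λ ≥ 9/2`, a gamma factor `γ(s) = Q^s ∏_j Γ(λ_j s + μ_j)` with the usual conditions,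
`Re(s) ∈ (1/2, (λ-1)/2)` and `σ₁ ∈ ((1-λ)/2, -Re(s))`, the integral
`F_λ(s,x) = (1/2πi)∫_{Re u = σ₁} [Γ_ℂ(u+(λ-1)/2) γ(1-s-u)]/[Γ_ℂ(-u+(λ+1)/2) γ(s+u)] x^u du`
converges absolutely for every `x > 0` and `|F_λ(s,x)| ≪ x^{σ₁}` uniformly in `x`. -/
theorem F_integral_bound (lam : ℝ) (hlam : 9 / 2 ≤ lam)
    (r : ℕ) (Q : ℝ) (lamj : Fin r → ℝ) (mu : Fin r → ℂ)
    (hQ : 0 < Q) (hlamj : ∀ j, 0 < lamj j) (hmu : ∀ j, -(lamj j) / 2 < (mu j).re)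
    (hsum : ∑ j, lamj j = 1)
    (γ : ℂ → ℂ)
    (hγ : ∀ w : ℂ, γ w = ((Q : ℂ) ^ w) * ∏ j, Complex.Gamma ((lamj j : ℂ) * w + mu j))
    (s : ℂ) (hs : 1 / 2 < s.re ∧ s.re < (lam - 1) / 2)
    (σ₁ : ℝ) (hσ₁ : (1 - lam) / 2 < σ₁ ∧ σ₁ < -s.re) :
    ∃ C : ℝ, ∀ x : ℝ, 0 < x →
      MeasureTheory.Integrable (fun t : ℝ =>
        (GammaC ((σ₁ + t * Complex.I) + ((lam : ℂ) - 1) / 2) * γ (1 - s - (σ₁ + t * Complex.I))) /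
          (GammaC (-(σ₁ + t * Complex.I) + ((lam : ℂ) + 1) / 2) * γ (s + (σ₁ + t * Complex.I))) *
        (x : ℂ) ^ ((σ₁ : ℂ) + t * Complex.I)) ∧
      ‖(1 / (2 * Real.pi * Complex.I)) *
          ∫ t : ℝ,
            (GammaC ((σ₁ + t * Complex.I) + ((lam : ℂ) - 1) / 2) *
                γ (1 - s - (σ₁ + t * Complex.I))) /
              (GammaC (-(σ₁ + t * Complex.I) + ((lam : ℂ) + 1) / 2) *
                γ (s + (σ₁ + t * Complex.I))) *
            (x : ℂ) ^ ((σ₁ : ℂ) + t * Complex.I) * Complex.I‖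
        ≤ C * x ^ σ₁ := by
  have hf : Continuous fun t : ℝ =>
      (GammaC ((σ₁ + t * Complex.I) + ((lam : ℂ) - 1) / 2) * γ (1 - s - (σ₁ + t * Complex.I))) /
        (GammaC (-(σ₁ + t * Complex.I) + ((lam : ℂ) + 1) / 2) * γ (s + (σ₁ + t * Complex.I))) := by
    simp only [div_eq_mul_inv _ (GammaC _ * γ _), mul_inv]
    refine Continuous.mul ?_ ?_
    · refine continuous_iff_continuousAt.2 fun t => ContinuousAt.mul ?_ ?_
      · refine (continuousAt_GammaC_of_re_pos ?_).comp
          (f := fun t : ℝ => (σ₁ + t * Complex.I) + ((lam : ℂ) - 1) / 2) (by fun_prop)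
        rw [show (σ₁ + t * Complex.I) + ((lam : ℂ) - 1) / 2 =
          (σ₁ + (lam - 1) / 2 : ℝ) + t * Complex.I by push_cast; ring]
        simp only [Complex.add_re, Complex.ofReal_re, Complex.re_ofReal_mul, Complex.I_re]
        linarith [hσ₁.1]
      · refine (continuousAt_gammaFactor hQ hγ fun j => ?_).comp
          (f := fun t : ℝ => 1 - s - (σ₁ + t * Complex.I)) (by fun_prop)
        simp only [Complex.add_re, Complex.sub_re, Complex.one_re, Complex.ofReal_re,
          Complex.re_ofReal_mul, Complex.I_re]
        nlinarith [hmu j, hlamj j, hσ₁.2]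
    · exact (continuous_GammaC_inv.comp (by fun_prop)).mul
        ((continuous_gammaFactor_inv hQ hγ).comp (by fun_prop))
  have hO : (fun t : ℝ =>
      (GammaC ((σ₁ + t * Complex.I) + ((lam : ℂ) - 1) / 2) * γ (1 - s - (σ₁ + t * Complex.I))) /
        (GammaC (-(σ₁ + t * Complex.I) + ((lam : ℂ) + 1) / 2) * γ (s + (σ₁ + t * Complex.I))))
      =O[cocompact ℝ] fun t => (1 + |t|) ^ (-(2 * s.re)) := by
    have h₁ := GammaC_isTheta_cocompact (σ₁ + (lam - 1) / 2 : ℝ) one_ne_zero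
    have h₂ := gammaFactor_isTheta_cocompact hQ hlamj mu hsum hγ (1 - s - σ₁)
      (neg_ne_zero.2 one_ne_zero)
    have h₃ := GammaC_isTheta_cocompact (-σ₁ + (lam + 1) / 2 : ℝ) (neg_ne_zero.2 one_ne_zero)
    have h₄ := gammaFactor_isTheta_cocompact hQ hlamj mu hsum hγ (s + σ₁) one_ne_zero
    refine ((h₁.mul h₂).div (h₃.mul h₄)).1.congr (fun t => ?_) (fun t => ?_)
    · push_cast
      ring_nf
    · have hB : 0 < 1 + |t| := by positivity
      simp only [abs_neg, abs_one, one_mul, Complex.ofReal_re, Complex.sub_re, Complex.one_re,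
        Complex.add_re]
      set S := ∑ j, ((mu j).re - 1 / 2)
      rw [div_eq_iff (by positivity)]
      set e := Real.exp (-(π / 2 * |t|))
      have h : (1 + |t|) ^ (σ₁ + (lam - 1) / 2 - 1 / 2) * (1 + |t|) ^ (1 - s.re - σ₁ + S) =
          (1 + |t|) ^ (-(2 * s.re)) * ((1 + |t|) ^ (-σ₁ + (lam + 1) / 2 - 1 / 2) *
            (1 + |t|) ^ (s.re + σ₁ + S)) := by
        simp only [← Real.rpow_add hB]
        congr 1
        ring
      linear_combination e ^ 2 * h
  have hint := integrable_of_continuous_of_isBigO_rpow hf (by linarith [hs.1]) hO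
  refine ⟨‖(1 / (2 * Real.pi * Complex.I) : ℂ)‖ * ∫ t : ℝ,
    ‖(GammaC ((σ₁ + t * Complex.I) + ((lam : ℂ) - 1) / 2) * γ (1 - s - (σ₁ + t * Complex.I))) /
      (GammaC (-(σ₁ + t * Complex.I) + ((lam : ℂ) + 1) / 2) * γ (s + (σ₁ + t * Complex.I)))‖,
    fun x hx => ?_⟩
  obtain ⟨hI, hle⟩ := integrable_mul_ofReal_cpow_and_norm_integral_le hint hx σ₁
  refine ⟨hI, ?_⟩
  rw [norm_mul]
  exact (mul_le_mul_of_nonneg_left hle (norm_nonneg _)).trans_eq (mul_assoc _ _ _).symm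
end

section
/- Let f(z) = Σ_{n≥1} f_n n^{(λ-1)/2} e^{2πinz} be a cusp form of half-integral weight λ, level 4N, and character χ, satisfying f(γz) = χ(d)·ε_d^{-2λ}·(c/d)·(cz+d)^λ·f(z) for γ = (a b; c d) ∈ Γ₀(4N), where (c/d) is the modified Jacobi symbol and ε_d = 1 or i according as d ≡ 1 or 3 mod 4. Then for c ∈ 4Nℤ_{>0} and integers a, ā with aā ≡ 1 mod c, the completed additive twist Λ_f(s, a/c) = Γ_ℂ(s+(λ-1)/2)·Σ_{n≥1} f_n e^{2πina/c} n^{-s} extends to an entire function and satisfies Λ_f(s, a/c) = i^λ · χ(ā) · ε_a^{-2λ} · (c/a) · c^{1-2s} · Λ_f(1-s, -ā/c). -/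
open scoped Real BigOperators

/-- `ε_d = 1` if `d ≡ 1 mod 4`, `ε_d = i` if `d ≡ 3 mod 4` (for odd `d`). -/
noncomputable def epsFactor (d : ℤ) : ℂ := if d % 4 = 1 then 1 else Complex.I

/-- Shimura's modified Jacobi symbol `(c/d)` for odd `d`: for `d > 0` it is the Jacobi
symbol `(c/|d|)`, and for `d < 0` it is `(c/|d|)` unless also `c < 0`, when it is
`-(c/|d|)`. -/
def shimuraJacobi (c d : ℤ) : ℤ :=
  if 0 ≤ d then jacobiSym c d.natAbs
  else if c < 0 then -(jacobiSym c d.natAbs) else jacobiSym c d.natAbs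

open Filter Topology Asymptotics Set MeasureTheory

section Jacobi

lemma jacobiSym_four_mul_left (c : ℤ) {n : ℕ} (hn : Odd n) :
    jacobiSym (4 * c) n = jacobiSym c n := by
  rw [jacobiSym.mul_left, jacobiSym.at_four hn, one_mul]

/-- The Kronecker character `(c / ·)` of a positive `c` divisible by `4` is even and trivial
on integers congruent to `1` modulo `c`. -/
lemma jacobiSym_natAbs_eq_one {c n : ℤ} (hc : 0 < c) (h4 : 4 ∣ c) (hn : n ≡ 1 [ZMOD c]) :
    jacobiSym c n.natAbs = 1 := by
  obtain ⟨e, rfl⟩ := h4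
  lift e to ℕ using by omega
  have he : 0 < e := by omega
  have hodd : Odd n.natAbs := by
    have h2 : n ≡ 1 [ZMOD 2] := hn.of_dvd ⟨2 * e, by ring⟩
    rw [Int.natAbs_odd, Int.odd_iff]
    exact h2
  rw [jacobiSym_four_mul_left _ hodd, jacobiSym.mod_right _ hodd, Int.natAbs_natCast]
  obtain ⟨k, hk⟩ := hn.symm.dvd
  obtain h0 | h0 := le_total 0 n
  · have : n.natAbs % (4 * e) = 1 := by
      have h1 : (n.natAbs : ℤ) % ((4 * e : ℕ) : ℤ) = 1 := by
        rw [Int.natCast_natAbs, abs_of_nonneg h0]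
        push_cast
        rw [hn]
        exact Int.emod_eq_of_lt (by norm_num) (by omega)
      exact_mod_cast h1
    rw [this, jacobiSym.one_right]
  · have : n.natAbs % (4 * e) = 4 * e - 1 := by
      have h1 : (n.natAbs : ℤ) % ((4 * e : ℕ) : ℤ) = 4 * e - 1 := by
        rw [Int.natCast_natAbs, abs_of_nonpos h0]
        push_cast
        have : -n = (4 * e - 1) + (4 * e) * (-k - 1) := by linear_combination -hk
        rw [this, Int.add_mul_emod_self_left]
        exact Int.emod_eq_of_lt (by omega) (by omega)
      omega
    have ho : Odd (4 * e - 1) := by rw [Nat.odd_iff]; omega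
    rw [this, ← jacobiSym_four_mul_left _ ho, jacobiSym.mod_left]
    have : (4 * (e : ℤ)) % ((4 * e - 1 : ℕ) : ℤ) = 1 := by
      have h : (4 * (e : ℤ)) = 1 + ((4 * e - 1 : ℕ) : ℤ) := by omega
      rw [h, Int.add_emod_right]
      exact Int.emod_eq_of_lt (by norm_num) (by omega)
    rw [this, jacobiSym.one_left]

lemma shimuraJacobi_eq_of_mul_modEq_one {c a d : ℤ} (hc : 0 < c) (h4 : 4 ∣ c)
    (h : a * d ≡ 1 [ZMOD c]) : shimuraJacobi c d = shimuraJacobi c a := by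
  have key : ∀ m : ℤ, shimuraJacobi c m = jacobiSym c m.natAbs := fun m ↦ by
    simp [shimuraJacobi, not_lt.mpr hc.le]
  have h1 := jacobiSym_natAbs_eq_one hc h4 h
  have h2 : a * d ≡ 1 [ZMOD 2] := h.of_dvd ((by norm_num : (2 : ℤ) ∣ 4).trans h4)
  have ha : a ≠ 0 := by rintro rfl; revert h2; simp [Int.ModEq]
  have hd : d ≠ 0 := by rintro rfl; revert h2; simp [Int.ModEq]
  rw [Int.natAbs_mul, jacobiSym.mul_right' _ (by simpa) (by simpa)] at h1
  rw [key, key]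
  rcases Int.eq_one_or_neg_one_of_mul_eq_one' h1 with ⟨h, h'⟩ | ⟨h, h'⟩ <;> rw [h, h']

lemma epsFactor_eq_of_mul_modEq_one {c a d : ℤ} (h4 : 4 ∣ c)
    (h : a * d ≡ 1 [ZMOD c]) : epsFactor d = epsFactor a := by
  have h1 : a * d % 4 = 1 := h.of_dvd h4
  have h2 : a % 4 = 1 ↔ d % 4 = 1 := by
    rw [Int.mul_emod] at h1
    have := Int.emod_nonneg a (by norm_num : (4 : ℤ) ≠ 0)
    have := Int.emod_lt_of_pos a (by norm_num : (0 : ℤ) < 4)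
    have := Int.emod_nonneg d (by norm_num : (4 : ℤ) ≠ 0)
    have := Int.emod_lt_of_pos d (by norm_num : (0 : ℤ) < 4)
    generalize a % 4 = x at *
    generalize d % 4 = y at *
    interval_cases x <;> interval_cases y <;> simp_all
  simp [epsFactor, h2]

end Jacobi

section Density

/-- A continuous function vanishing at the rationals `a / M ^ (k + 1)` with `a ≡ 1` modulo `M`
vanishes identically. -/
lemma Continuous.eq_zero_of_forall_div_pow {H : ℝ → ℂ} (hH : Continuous H) {M : ℕ} (hM : 1 < M)
    (h : ∀ (k : ℕ) (j : ℤ), H (((M * j + 1 : ℤ) : ℝ) / ((M ^ (k + 1) : ℤ) : ℝ)) = 0) (x : ℝ) :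
    H x = 0 := by
  have hM' : (1 : ℝ) < M := by exact_mod_cast hM
  let u : ℕ → ℝ := fun k ↦ ((M * ⌊x * M ^ k⌋ + 1 : ℤ) : ℝ) / ((M ^ (k + 1) : ℤ) : ℝ)
  have hu : Tendsto u atTop (𝓝 x) := by
    rw [tendsto_iff_norm_sub_tendsto_zero]
    refine squeeze_zero (fun _ ↦ norm_nonneg _) (g := fun k : ℕ ↦ ((M : ℝ)⁻¹) ^ k) (fun k ↦ ?_)
      (tendsto_pow_atTop_nhds_zero_of_lt_one (by positivity) (inv_lt_one_of_one_lt₀ hM'))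
    have h1 := Int.floor_le (x * M ^ k)
    have h2 := Int.lt_floor_add_one (x * M ^ k)
    have hp : (0 : ℝ) < M ^ k := by positivity
    have h3 : u k - x = ((⌊x * M ^ k⌋ : ℝ) + (M : ℝ)⁻¹ - x * M ^ k) / M ^ k := by
      simp only [u]
      push_cast
      field_simp
      ring
    have h4 : (M : ℝ)⁻¹ ≤ 1 := (inv_lt_one_of_one_lt₀ hM').le
    have h5 : (0 : ℝ) < (M : ℝ)⁻¹ := by positivity
    rw [h3, norm_div, Real.norm_eq_abs, Real.norm_eq_abs, abs_of_pos hp, inv_pow,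
      div_le_iff₀ hp, inv_mul_cancel₀ hp.ne', abs_le]
    constructor <;> linarith
  have := (hH.tendsto x).comp hu
  refine tendsto_nhds_unique this (tendsto_const_nhds.congr fun k ↦ ?_)
  exact (h k _).symm

end Density

section Fourier

/-- Absolutely convergent Fourier series are determined by their values. -/
lemma eq_zero_of_fourier_series_eq_zero {b : ℕ+ → ℂ} (hb : Summable fun n ↦ ‖b n‖)
    (h : ∀ x : ℝ, ∑' n : ℕ+, b n * Complex.exp (2 * Real.pi * Complex.I * n * x) = 0) :
    b = 0 := by
  let v : ℕ+ → C(AddCircle (1 : ℝ), ℂ) := fun n ↦ b n • fourier (n : ℤ)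
  have hv : Summable v := by
    refine Summable.of_norm (hb.congr fun n ↦ ?_)
    simp [v, norm_smul, fourier_norm]
  have h0 : HasSum v 0 := by
    have := hv.hasSum
    convert this using 1
    ext x
    obtain ⟨x, rfl⟩ := QuotientAddGroup.mk_surjective x
    rw [ContinuousMap.zero_apply, ← (ContinuousMap.hasSum_apply this _).tsum_eq, ← h x]
    refine tsum_congr fun n ↦ ?_
    simp only [v, ContinuousMap.smul_apply, smul_eq_mul]
    congr 1
    refine Eq.trans ?_ (fourier_coe_apply (T := 1) (n := (n : ℤ)) (x := x)).symm
    simp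
  have h1 := (ContinuousMap.toLp (E := ℂ) 2 (AddCircle.haarAddCircle (T := (1 : ℝ))) ℂ).hasSum h0
  ext m
  have h2 := (innerSL ℂ (fourierLp (T := (1 : ℝ)) 2 (m : ℤ))).hasSum h1
  have h3 : ∀ n : ℕ+, inner ℂ (fourierLp (T := (1 : ℝ)) 2 (m : ℤ))
      (fourierLp (T := (1 : ℝ)) 2 (n : ℤ)) = if m = n then (1 : ℂ) else 0 := fun n ↦ by
    rw [orthonormal_iff_ite.mp (orthonormal_fourier (T := (1 : ℝ)))]
    simp
  have h4 : (fun n ↦ if m = n then b n else 0) =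
      (innerSL ℂ (fourierLp (T := (1 : ℝ)) 2 (m : ℤ))) ∘
        (ContinuousMap.toLp (E := ℂ) 2 (AddCircle.haarAddCircle (T := (1 : ℝ))) ℂ) ∘ v := by
    ext n
    have := h3 n
    simp only [fourierLp] at this
    simp [v, inner_smul_right, fourierLp, this]
  change HasSum (_ ∘ _ ∘ v) _ at h2
  rw [← h4] at h2
  simp only [map_zero] at h2
  have h5 := hasSum_ite_eq m (b m)
  have h6 : (fun n ↦ if m = n then b n else 0) = fun n ↦ if n = m then b m else 0 := by
    ext n
    by_cases hmn : n = m
    · simp [hmn]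
    · simp [hmn, Ne.symm hmn]
  rw [h6] at h2
  exact h5.unique h2

end Fourier

section QSeries

/-- The Fourier series `∑ b n e(n z)` over positive integers. -/
noncomputable def qSeries (b : ℕ+ → ℂ) (z : ℂ) : ℂ :=
  ∑' n : ℕ+, b n * Complex.exp (2 * Real.pi * Complex.I * n * z)

lemma norm_qSeries_term (b : ℕ+ → ℂ) (n : ℕ+) (z : ℂ) :
    ‖b n * Complex.exp (2 * Real.pi * Complex.I * n * z)‖ =
      ‖b n‖ * Real.exp (-(2 * Real.pi * z.im) * n) := by
  rw [norm_mul, Complex.norm_exp]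
  congr 2
  simp [Complex.mul_re, Complex.mul_im]
  ring

lemma summable_pnat_rpow_mul_exp (B : ℝ) {r : ℝ} (hr : 0 < r) :
    Summable fun n : ℕ+ ↦ ((n : ℕ) : ℝ) ^ B * Real.exp (-r * n) := by
  have h := (Real.summable_pow_mul_exp_neg_nat_mul ⌈B⌉₊ hr).comp_injective PNat.coe_injective
  refine Summable.of_nonneg_of_le (fun n ↦ by positivity) (fun n ↦ ?_) h
  simp only [Function.comp_apply]
  gcongr
  rw [← Real.rpow_natCast]
  exact Real.rpow_le_rpow_of_exponent_le (by exact_mod_cast n.pos) (Nat.le_ceil B)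

variable {b : ℕ+ → ℂ} {C B : ℝ}

lemma summable_norm_mul_exp (hb : ∀ n : ℕ+, ‖b n‖ ≤ C * ((n : ℕ) : ℝ) ^ B) {r : ℝ} (hr : 0 < r) :
    Summable fun n : ℕ+ ↦ ‖b n‖ * Real.exp (-r * n) := by
  refine Summable.of_nonneg_of_le (fun n ↦ by positivity) (fun n ↦ ?_)
    ((summable_pnat_rpow_mul_exp B hr).mul_left C)
  rw [← mul_assoc]
  gcongr
  exact hb n

lemma summable_qSeries_term (hb : ∀ n : ℕ+, ‖b n‖ ≤ C * ((n : ℕ) : ℝ) ^ B) {z : ℂ}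
    (hz : 0 < z.im) :
    Summable fun n : ℕ+ ↦ b n * Complex.exp (2 * Real.pi * Complex.I * n * z) := by
  refine Summable.of_norm ?_
  simp_rw [norm_qSeries_term]
  exact summable_norm_mul_exp hb (by positivity)

lemma continuousOn_qSeries_vertical (hb : ∀ n : ℕ+, ‖b n‖ ≤ C * ((n : ℕ) : ℝ) ^ B) (x : ℝ) :
    ContinuousOn (fun y : ℝ ↦ qSeries b (x + y * Complex.I)) (Ioi 0) := by
  refine continuousOn_of_forall_continuousAt fun y hy ↦ ?_
  have hy : 0 < y := hy
  have : ContinuousOn (fun y : ℝ ↦ qSeries b (x + y * Complex.I)) (Ici (y / 2)) := by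
    refine continuousOn_tsum (u := fun n : ℕ+ ↦ ‖b n‖ * Real.exp (-(2 * Real.pi * (y / 2)) * n))
      (fun n ↦ by fun_prop) (summable_norm_mul_exp hb (by positivity)) fun n t ht ↦ ?_
    have ht : y / 2 ≤ t := ht
    rw [norm_qSeries_term]
    gcongr
    simpa using ht
  exact this.continuousAt (Ici_mem_nhds (by linarith))

lemma isBigO_qSeries_vertical (hb : ∀ n : ℕ+, ‖b n‖ ≤ C * ((n : ℕ) : ℝ) ^ B) (x a : ℝ) :
    (fun y : ℝ ↦ qSeries b (x + y * Complex.I)) =O[atTop] (· ^ (-a)) := by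
  refine IsBigO.trans ?_ (isLittleO_exp_neg_mul_rpow_atTop (a := 2 * Real.pi)
    (by positivity) (-a)).isBigO
  have hs : Summable fun n : ℕ+ ↦ ‖b n‖ * Real.exp (-(2 * Real.pi) * n) :=
    summable_norm_mul_exp hb (by positivity)
  refine IsBigO.of_bound (Real.exp (2 * Real.pi) *
    ∑' n : ℕ+, ‖b n‖ * Real.exp (-(2 * Real.pi) * n)) ?_
  filter_upwards [eventually_ge_atTop 1] with y hy
  have hz : 0 < ((x : ℂ) + y * Complex.I).im := by simp; linarith
  have hsum := (summable_qSeries_term hb hz).norm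
  rw [Real.norm_of_nonneg (Real.exp_nonneg _), mul_comm (Real.exp _), mul_assoc, ← tsum_mul_right]
  refine (norm_tsum_le_tsum_norm hsum).trans (hsum.tsum_le_tsum (fun n ↦ ?_) (hs.mul_right _))
  rw [norm_qSeries_term, mul_assoc ‖b n‖, ← Real.exp_add, ← Real.exp_add]
  gcongr
  have hn : (1 : ℝ) ≤ (n : ℕ) := by exact_mod_cast n.pos
  simp only [Complex.add_im, Complex.ofReal_im, Complex.mul_im, Complex.ofReal_re,
    Complex.I_im, Complex.I_re, mul_one, mul_zero, add_zero, zero_add]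
  nlinarith [mul_nonneg Real.pi_pos.le (mul_nonneg (sub_nonneg.2 hn) (sub_nonneg.2 hy))]

/-- The Mellin transform of a Fourier series along a vertical line is a Dirichlet series. -/
lemma mellin_qSeries_vertical (hb : ∀ n : ℕ+, ‖b n‖ ≤ C * ((n : ℕ) : ℝ) ^ B) (x : ℝ) {w : ℂ}
    (hw : 0 < w.re) (hBw : B + 1 < w.re) :
    mellin (fun y : ℝ ↦ qSeries b (x + y * Complex.I)) w =
      ((2 * Real.pi : ℝ) : ℂ) ^ (-w) * Complex.Gamma w *
        ∑' n : ℕ+, b n * Complex.exp (2 * Real.pi * Complex.I * n * x) / ((n : ℕ) : ℂ) ^ w := by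
  have hnorm (n : ℕ+) : ‖b n * Complex.exp (2 * Real.pi * Complex.I * n * x)‖ = ‖b n‖ := by
    rw [norm_qSeries_term]; simp
  have h := hasSum_mellin (a := fun n : ℕ+ ↦ b n * Complex.exp (2 * Real.pi * Complex.I * n * x))
    (p := fun n : ℕ+ ↦ 2 * Real.pi * n) (s := w)
    (F := fun y : ℝ ↦ qSeries b (x + y * Complex.I))
    (fun n ↦ Or.inr (by have := n.pos; positivity)) hw (fun t ht ↦ ?_) ?_
  · rw [← h.tsum_eq, ← tsum_mul_left]
    refine tsum_congr fun n ↦ ?_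
    have h2 : ((2 * Real.pi * n : ℝ) : ℂ) ^ w =
        ((2 * Real.pi : ℝ) : ℂ) ^ w * ((n : ℕ) : ℂ) ^ w := by
      rw [Complex.ofReal_mul, Complex.mul_cpow_ofReal_nonneg (by positivity) (by positivity)]
      simp
    rw [h2, Complex.cpow_neg]
    field_simp
  · have hz : 0 < ((x : ℂ) + t * Complex.I).im := by simpa using ht
    have key : HasSum _ (qSeries b (x + t * Complex.I)) := (summable_qSeries_term hb hz).hasSum
    convert key using 1
    ext n
    rw [mul_assoc, Complex.ofReal_exp, ← Complex.exp_add]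
    congr 2
    push_cast
    linear_combination (-2 * Real.pi * n * t) * Complex.I_sq
  · have hs : Summable fun n : ℕ+ ↦ ((n : ℕ) : ℝ) ^ (B - w.re) :=
      (Real.summable_nat_rpow.mpr (by linarith)).comp_injective PNat.coe_injective
    refine Summable.of_nonneg_of_le (fun n ↦ by positivity) (fun n ↦ ?_)
      (hs.mul_left (C / (2 * Real.pi) ^ w.re))
    have hn : (0 : ℝ) < (n : ℕ) := by exact_mod_cast n.pos
    rw [hnorm, Real.mul_rpow (by positivity) hn.le, Real.rpow_sub hn]
    refine (div_le_div_of_nonneg_right (hb n) (by positivity)).trans_eq ?_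
    field_simp

end QSeries

section Inversion

variable {G₁ G₂ : ℝ → ℂ} {κ : ℂ} {l r : ℝ}

lemma isBigO_nhdsGT_zero_of_inversion (hr : 0 < r) (hG₂ : ∀ a : ℝ, G₂ =O[atTop] (· ^ (-a)))
    (h : ∀ y : ℝ, 0 < y → G₁ y = κ * ((y : ℂ) ^ (-(l : ℂ)) * G₂ (r * y⁻¹))) (b : ℝ) :
    G₁ =O[𝓝[>] 0] (· ^ (-b)) := by
  have ht : Tendsto (fun y : ℝ ↦ r * y⁻¹) (𝓝[>] 0) atTop :=
    tendsto_inv_nhdsGT_zero.const_mul_atTop hr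
  have h1 := (hG₂ (l - b)).comp_tendsto ht
  have h2 : (fun y : ℝ ↦ (y : ℂ) ^ (-(l : ℂ))) =O[𝓝[>] 0] fun y : ℝ ↦ y ^ (-l) := by
    refine IsBigO.of_bound 1 ?_
    filter_upwards [self_mem_nhdsWithin] with y hy
    rw [Complex.norm_cpow_eq_rpow_re_of_pos hy, one_mul]
    simpa using le_abs_self _
  have h3 := (h2.mul h1).const_mul_left κ
  refine (h3.congr' (f₂ := G₁) (g₂ := fun y ↦ r ^ (-(l - b)) * y ^ (-b)) ?_ ?_).trans
    (isBigO_const_mul_self _ _ _)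
  · filter_upwards [self_mem_nhdsWithin] with y hy
    exact (h y hy).symm
  · filter_upwards [self_mem_nhdsWithin] with y hy
    have hy : 0 < y := hy
    simp only [Function.comp_apply]
    rw [Real.mul_rpow hr.le (by positivity), Real.inv_rpow hy.le, ← Real.rpow_neg hy.le,
      mul_left_comm, ← Real.rpow_add hy]
    congr 2
    ring

lemma differentiable_mellin_of_inversion (hr : 0 < r) (hc : ContinuousOn G₁ (Ioi 0))
    (hG₁ : ∀ a : ℝ, G₁ =O[atTop] (· ^ (-a))) (hG₂ : ∀ a : ℝ, G₂ =O[atTop] (· ^ (-a)))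
    (h : ∀ y : ℝ, 0 < y → G₁ y = κ * ((y : ℂ) ^ (-(l : ℂ)) * G₂ (r * y⁻¹))) :
    Differentiable ℂ (mellin G₁) := fun s ↦
  mellin_differentiableAt_of_isBigO_rpow (hc.locallyIntegrableOn measurableSet_Ioi)
    (hG₁ (s.re + 1)) (lt_add_one _) (isBigO_nhdsGT_zero_of_inversion hr hG₂ h (s.re - 1))
    (sub_one_lt _)

lemma mellin_eq_of_inversion (hr : 0 < r)
    (h : ∀ y : ℝ, 0 < y → G₁ y = κ * ((y : ℂ) ^ (-(l : ℂ)) * G₂ (r * y⁻¹))) (w : ℂ) :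
    mellin G₁ w = κ * ((r : ℂ) ^ (w - l) * mellin G₂ (l - w)) := by
  have h1 : mellin G₁ w =
      mellin (fun y : ℝ ↦ κ • ((y : ℂ) ^ (-(l : ℂ)) • G₂ (r * y⁻¹))) w :=
    setIntegral_congr_fun measurableSet_Ioi fun y hy ↦ by simp [h y hy]
  have h2 := mellin_comp_inv (fun u ↦ G₂ (r * u)) (w + -(l : ℂ))
  rw [h1, mellin_const_smul, mellin_cpow_smul, h2, mellin_comp_mul_left _ _ hr, smul_eq_mul,
    smul_eq_mul, neg_neg, neg_add_rev, neg_neg, ← sub_eq_add_neg, ← sub_eq_add_neg]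

end Inversion

section Automorphy

/-- The transformation law of an automorphic function along vertical lines. -/
lemma automorphy_vertical {F : ℂ → ℂ} {μ : ℂ} {l : ℝ} {a b c d : ℤ} (hdet : a * d - b * c = 1)
    (hc : 0 < c)
    (h : ∀ z : ℂ, 0 < z.im → F ((a * z + b) / (c * z + d)) = μ * (c * z + d) ^ (l : ℂ) * F z)
    {y : ℝ} (hy : 0 < y) :
    F (((a / c : ℝ) : ℂ) + y * Complex.I) =
      (μ * Complex.I ^ (l : ℂ) * (c : ℂ) ^ (-(l : ℂ))) * ((y : ℂ) ^ (-(l : ℂ)) *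
        F (((-d / c : ℝ) : ℂ) + (((c : ℝ) ^ 2)⁻¹ * y⁻¹ : ℝ) * Complex.I)) := by
  have hc' : (0 : ℝ) < c := by exact_mod_cast hc
  have hcC : (c : ℂ) ≠ 0 := by exact_mod_cast hc.ne'
  have hyC : (y : ℂ) ≠ 0 := by exact_mod_cast hy.ne'
  set z : ℂ := ((-d / c : ℝ) : ℂ) + (((c : ℝ) ^ 2)⁻¹ * y⁻¹ : ℝ) * Complex.I with hz
  have him : 0 < z.im := by
    rw [hz]
    simp only [Complex.add_im, Complex.ofReal_im, Complex.im_ofReal_mul,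
      Complex.I_im, mul_one, zero_add]
    positivity
  have hden : (c : ℂ) * z + d = (((c : ℝ) * y)⁻¹ : ℝ) * Complex.I := by
    rw [hz]; push_cast; field_simp; ring
  have hdet' : (a : ℂ) * d - b * c = 1 := by exact_mod_cast hdet
  have hquot : ((a : ℂ) * z + b) / (c * z + d) = ((a / c : ℝ) : ℂ) + y * Complex.I := by
    rw [hden, hz, div_eq_iff (by simp [hcC, hyC])]
    push_cast
    field_simp
    linear_combination (-c * y) * hdet' - (c * y) * Complex.I_sq
  have hpow : ((((c : ℝ) * y)⁻¹ : ℝ) * Complex.I) ^ (l : ℂ) =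
      Complex.I ^ (l : ℂ) * (c : ℂ) ^ (-(l : ℂ)) * (y : ℂ) ^ (-(l : ℂ)) := by
    have hp : (0 : ℝ) < ((c : ℝ) * y)⁻¹ := by positivity
    rw [Complex.cpow_def_of_ne_zero (by simp [hcC, hyC]), Complex.log_ofReal_mul hp Complex.I_ne_zero,
      Complex.cpow_def_of_ne_zero Complex.I_ne_zero, Complex.cpow_def_of_ne_zero hcC,
      Complex.cpow_def_of_ne_zero hyC, ← Complex.exp_add, ← Complex.exp_add, Real.log_inv,
      Real.log_mul hc'.ne' hy.ne', ← Complex.ofReal_intCast c]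
    push_cast
    rw [← Complex.ofReal_intCast c, Complex.ofReal_log hc'.le, Complex.ofReal_log hy.le]
    congr 1
    ring
  rw [← hquot, h z him, hden, hpow]
  ring

end Automorphy

section Rigidity

/-- A Fourier series converging absolutely on the real line and tending to zero vertically at the
rationals `a / M ^ (k + 1)` with `a ≡ 1` modulo `M` is identically zero. -/
lemma eq_zero_of_tendsto_qSeries_vertical {b : ℕ+ → ℂ} (hb : Summable fun n ↦ ‖b n‖) {M : ℕ}
    (hM : 1 < M)
    (h : ∀ (k : ℕ) (j : ℤ), Tendsto (fun y : ℝ ↦ qSeries b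
      (((((M * j + 1 : ℤ) : ℝ) / ((M ^ (k + 1) : ℤ) : ℝ) : ℝ) : ℂ) + y * Complex.I))
        (𝓝[>] 0) (𝓝 0)) :
    b = 0 := by
  have hcont : ContinuousOn (qSeries b) {z | 0 ≤ z.im} := by
    refine continuousOn_tsum (fun n ↦ by fun_prop) hb fun n z hz ↦ ?_
    have hz : 0 ≤ z.im := hz
    rw [norm_qSeries_term]
    refine mul_le_of_le_one_right (norm_nonneg _) (Real.exp_le_one_iff.2 ?_)
    have : 0 ≤ 2 * Real.pi * z.im * n := by positivity
    linarith
  have hH : Continuous fun x : ℝ ↦ qSeries b x :=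
    hcont.comp_continuous Complex.continuous_ofReal fun x ↦ by simp
  refine eq_zero_of_fourier_series_eq_zero hb fun x ↦
    hH.eq_zero_of_forall_div_pow hM (fun k j ↦ ?_) x
  refine tendsto_nhds_unique ?_ (h k j)
  generalize ((M * j + 1 : ℤ) : ℝ) / ((M ^ (k + 1) : ℤ) : ℝ) = x₀
  have h1 : ContinuousOn (fun y : ℝ ↦ qSeries b (x₀ + y * Complex.I)) (Ici 0) :=
    hcont.comp (by fun_prop) fun y hy ↦ by simpa using hy
  have h2 := (h1 0 self_mem_Ici).tendsto.mono_left (nhdsWithin_mono _ Ioi_subset_Ici_self)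
  simpa using h2

end Rigidity

/-- Functional equation for the additive twists of a half-integral weight cusp form:
if `f(z) = Σ_{n≥1} f_n n^{(λ-1)/2} e(nz)` (with polynomially bounded coefficients)
transforms under `Γ₀(4N)` with weight `λ`, character `χ` and the theta multiplier, then
for `c ∈ 4Nℤ_{>0}` and `a ā` with `aā ≡ 1 mod c`, the completed additive twist
`Λ_f(s, a/c) = Γ_ℂ(s+(λ-1)/2) Σ_{n≥1} f_n e(na/c) n^{-s}` extends to an entire function and
`Λ_f(s, a/c) = i^λ χ(ā) ε_a^{-2λ} (c/a) c^{1-2s} Λ_f(1-s, -ā/c)`. -/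
theorem functional_equation_additive_twist
    (N : ℕ) (hN : 0 < N) (χ : DirichletCharacter ℂ (4 * N))
    (lam : ℝ) (hhalf : ∃ k : ℤ, lam = (k : ℝ) + 1 / 2)
    (f : ℕ+ → ℂ) (A Cf : ℝ) (hgrowth : ∀ n : ℕ+, ‖f n‖ ≤ Cf * ((n : ℕ) : ℝ) ^ A)
    (F : ℂ → ℂ)
    (hF : ∀ z : ℂ, F z = ∑' n : ℕ+, f n * ((n : ℕ) : ℂ) ^ (((lam : ℂ) - 1) / 2) *
      Complex.exp (2 * Real.pi * Complex.I * n * z))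
    (hmod : ∀ a b c d : ℤ, a * d - b * c = 1 → (4 * (N : ℤ)) ∣ c →
      ∀ z : ℂ, 0 < z.im →
        F (((a : ℂ) * z + b) / ((c : ℂ) * z + d))
          = χ (d : ZMod (4 * N)) * (epsFactor d) ^ (-2 * (lam : ℂ)) *
            (shimuraJacobi c d : ℂ) * ((c : ℂ) * z + d) ^ (lam : ℂ) * F z) :
    ∀ c : ℤ, 0 < c → (4 * (N : ℤ)) ∣ c → ∀ a abar : ℤ, a * abar ≡ 1 [ZMOD c] →
      ∃ Λ₁ Λ₂ : ℂ → ℂ, Differentiable ℂ Λ₁ ∧ Differentiable ℂ Λ₂ ∧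
        (∀ s : ℂ, A + 2 < s.re →
          Λ₁ s = GammaC (s + ((lam : ℂ) - 1) / 2) *
            ∑' n : ℕ+, f n * Complex.exp (2 * Real.pi * Complex.I * n * a / c) /
              ((n : ℕ) : ℂ) ^ s) ∧
        (∀ s : ℂ, A + 2 < s.re →
          Λ₂ s = GammaC (s + ((lam : ℂ) - 1) / 2) *
            ∑' n : ℕ+, f n * Complex.exp (2 * Real.pi * Complex.I * n * (-abar) / c) /
              ((n : ℕ) : ℂ) ^ s) ∧
        (∀ s : ℂ, Λ₁ s = Complex.I ^ (lam : ℂ) * χ (abar : ZMod (4 * N)) *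
          (epsFactor a) ^ (-2 * (lam : ℂ)) * (shimuraJacobi c a : ℂ) *
          ((c : ℂ)) ^ (1 - 2 * s) * Λ₂ (1 - s)) := by
  let b : ℕ+ → ℂ := fun n ↦ f n * ((n : ℕ) : ℂ) ^ (((lam : ℂ) - 1) / 2)
  have hre : (((lam : ℂ) - 1) / 2).re = (lam - 1) / 2 := by
    rw [show ((lam : ℂ) - 1) / 2 = (((lam - 1) / 2 : ℝ) : ℂ) by push_cast; rfl, Complex.ofReal_re]
  have hb : ∀ n : ℕ+, ‖b n‖ ≤ Cf * ((n : ℕ) : ℝ) ^ (A + (lam - 1) / 2) := fun n ↦ by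
    have hn : (0 : ℝ) < (n : ℕ) := by exact_mod_cast n.pos
    rw [norm_mul, Complex.norm_natCast_cpow_of_pos n.pos, hre, Real.rpow_add hn, ← mul_assoc]
    gcongr
    exact hgrowth n
  obtain rfl : F = qSeries b := funext hF
  have h4 {c : ℤ} (hNc : 4 * (N : ℤ) ∣ c) : 4 ∣ c := (dvd_mul_right _ _).trans hNc
  have htrans {c : ℤ} (hc : 0 < c) (hNc : 4 * (N : ℤ) ∣ c) {a d : ℤ} (had : a * d ≡ 1 [ZMOD c])
      {y : ℝ} (hy : 0 < y) : qSeries b (((a / c : ℝ) : ℂ) + y * Complex.I) =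
        (χ (d : ZMod (4 * N)) * (epsFactor a) ^ (-2 * (lam : ℂ)) * (shimuraJacobi c a : ℂ) *
          Complex.I ^ (lam : ℂ) * (c : ℂ) ^ (-(lam : ℂ))) * ((y : ℂ) ^ (-(lam : ℂ)) *
          qSeries b (((-d / c : ℝ) : ℂ) + (((c : ℝ) ^ 2)⁻¹ * y⁻¹ : ℝ) * Complex.I)) := by
    obtain ⟨e, he⟩ := had.symm.dvd
    have hdet : a * d - e * c = 1 := by linear_combination he
    rw [← epsFactor_eq_of_mul_modEq_one (h4 hNc) had,
      ← shimuraJacobi_eq_of_mul_modEq_one hc (h4 hNc) had]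
    exact automorphy_vertical hdet hc (hmod a e c d hdet hNc) hy
  have hdecay (x : ℝ) := isBigO_qSeries_vertical hb x
  -- either the coefficients decay so fast that they all vanish, or the Mellin integrals converge
  have hdich : b = 0 ∨ -1 ≤ A + (lam - 1) / 2 := by
    refine or_iff_not_imp_right.2 fun hB ↦ ?_
    have hsum : Summable fun n ↦ ‖b n‖ :=
      Summable.of_nonneg_of_le (fun n ↦ norm_nonneg _) hb
        (((Real.summable_nat_rpow.mpr (not_le.1 hB)).comp_injective PNat.coe_injective).mul_left Cf)
    refine eq_zero_of_tendsto_qSeries_vertical hsum (M := 4 * N) (by omega) fun k j ↦ ?_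
    have hMpos : (0 : ℤ) < ((4 * N : ℕ) : ℤ) := by omega
    have hc : (0 : ℤ) < ((4 * N : ℕ) : ℤ) ^ (k + 1) := pow_pos hMpos _
    have hNc : 4 * (N : ℤ) ∣ ((4 * N : ℕ) : ℤ) ^ (k + 1) := by
      push_cast; exact dvd_pow_self _ (by simp)
    obtain ⟨u, v, huv⟩ : IsCoprime (((4 * N : ℕ) : ℤ) * j + 1) (((4 * N : ℕ) : ℤ) ^ (k + 1)) :=
      IsCoprime.pow_right ⟨1, -j, by ring⟩
    have had : (((4 * N : ℕ) : ℤ) * j + 1) * u ≡ 1 [ZMOD ((4 * N : ℕ) : ℤ) ^ (k + 1)] :=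
      (Int.modEq_iff_dvd.2 ⟨v, by linear_combination -huv⟩)
    have hO := isBigO_nhdsGT_zero_of_inversion (b := -1) (by positivity) (hdecay _)
      (fun y hy ↦ htrans hc hNc had hy)
    refine hO.trans_tendsto ?_
    simpa [Function.id_def] using (tendsto_id (α := ℝ)).mono_left nhdsWithin_le_nhds
  have hL (x : ℝ) {s : ℂ} (hs : A + 2 < s.re) :
      2 * mellin (fun y : ℝ ↦ qSeries b (x + y * Complex.I)) (s + ((lam : ℂ) - 1) / 2) =
        GammaC (s + ((lam : ℂ) - 1) / 2) * ∑' n : ℕ+,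
          f n * Complex.exp (2 * Real.pi * Complex.I * n * x) / ((n : ℕ) : ℂ) ^ s := by
    rcases hdich with h0 | hB
    · have hf : ∀ n, f n = 0 := fun n ↦ by
        have := congrFun h0 n
        simpa [b, Complex.cpow_eq_zero_iff] using this
      simp [qSeries, h0, hf, mellin]
    · rw [mellin_qSeries_vertical hb x (by rw [Complex.add_re, hre]; linarith)
        (by rw [Complex.add_re, hre]; linarith), GammaC, ← mul_assoc, ← mul_assoc]
      congr 1
      refine tsum_congr fun n ↦ ?_
      have hn : ((n : ℕ) : ℂ) ≠ 0 := by exact_mod_cast n.ne_zero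
      have hn' : ((n : ℕ) : ℂ) ^ (((lam : ℂ) - 1) / 2) ≠ 0 := by
        simp [Complex.cpow_eq_zero_iff]
      simp only [b]
      rw [Complex.cpow_add _ _ hn]
      field_simp
  intro c hc hNc a abar had
  have hc' : (0 : ℝ) < c := by exact_mod_cast hc
  have hcC : (c : ℂ) ≠ 0 := by exact_mod_cast hc.ne'
  have hr : (0 : ℝ) < ((c : ℝ) ^ 2)⁻¹ := by positivity
  have had' : -abar * -a ≡ 1 [ZMOD c] := by rwa [neg_mul_neg, mul_comm]
  have hdiff {a d : ℤ} (had : a * d ≡ 1 [ZMOD c]) :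
      Differentiable ℂ (mellin fun y : ℝ ↦ qSeries b (((a / c : ℝ) : ℂ) + y * Complex.I)) :=
    differentiable_mellin_of_inversion hr (continuousOn_qSeries_vertical hb _) (hdecay _)
      (hdecay _) fun y hy ↦ htrans hc hNc had hy
  refine ⟨fun s ↦ 2 * mellin (fun y : ℝ ↦ qSeries b (((a / c : ℝ) : ℂ) + y * Complex.I))
      (s + ((lam : ℂ) - 1) / 2),
    fun s ↦ 2 * mellin (fun y : ℝ ↦ qSeries b (((-abar / c : ℝ) : ℂ) + y * Complex.I))
      (s + ((lam : ℂ) - 1) / 2), ?_, ?_, fun s hs ↦ ?_, fun s hs ↦ ?_, fun s ↦ ?_⟩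
  · exact ((hdiff had).comp (differentiable_id.add_const _)).const_mul 2
  · have := hdiff had'
    rw [Int.cast_neg abar] at this
    exact (this.comp (differentiable_id.add_const _)).const_mul 2
  · simp only [hL _ hs]
    push_cast
    simp only [mul_div_assoc]
  · simp only [hL _ hs]
    push_cast
    simp only [mul_div_assoc]
  · have hfe := mellin_eq_of_inversion
      (G₂ := fun y : ℝ ↦ qSeries b (((-abar / c : ℝ) : ℂ) + y * Complex.I)) hr (fun y hy ↦ htrans hc hNc had hy)
      (s + ((lam : ℂ) - 1) / 2)
    have hw : (lam : ℂ) - (s + ((lam : ℂ) - 1) / 2) = 1 - s + ((lam : ℂ) - 1) / 2 := by ring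
    have hpow : (c : ℂ) ^ (-(lam : ℂ)) *
        (((((c : ℝ) ^ 2)⁻¹ : ℝ)) : ℂ) ^ (s + ((lam : ℂ) - 1) / 2 - lam) =
          (c : ℂ) ^ (1 - 2 * s) := by
      have hlog : Complex.log ((((c : ℝ) ^ 2)⁻¹ : ℝ) : ℂ) = -2 * Complex.log c := by
        rw [← Complex.ofReal_log hr.le, Real.log_inv, Real.log_pow, ← Complex.ofReal_intCast c,
          ← Complex.ofReal_log hc'.le]
        push_cast
        ring
      rw [Complex.cpow_def_of_ne_zero hcC, Complex.cpow_def_of_ne_zero hcC,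
        Complex.cpow_def_of_ne_zero (by exact_mod_cast hr.ne'), hlog, ← Complex.exp_add]
      congr 1
      ring
    simp only
    rw [hfe, hw, ← hpow]
    ring
end
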